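/- arXiv:1910.04320 — 4 statements merged into one kernel-verified Lean document; each statement's English description precedes it below -/
import Mathlib

section
/- Fix an integer k ≥ 2 and distinct real numbers c_1,…,c_k, and set C_0 = min_{1≤i<j≤k}(c_i−c_j)². For each n, let n_1(n) ≥ … ≥ n_k(n) be positive integers summing to n, and assume there is a constant c > 0 (independent of n) with n_k(n) ≥ c·n for all n. Let y_n ∈ Ω_{n_1(n),…,n_k(n)} be the true color assignment and T_n = G(y_n) + σ_n W_n the observation. If there is a constant δ > 0 (independent of n) such that σ_n² < (1−δ)·n·C_0/(4 log n) for all n, then as n → ∞ both of the following probabilities tend to 1: (i) the probability that y_n is the unique minimizer of ‖T_n − G(x)‖_F² over x ∈ Ω_{n_1(n),…,n_k(n)}; (ii) the probability that y_n is the unique minimizer of ‖T_n − G(x)‖_F² over x ∈ Ω. -/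
open MeasureTheory ProbabilityTheory Filter Finset

/-- The law of an `n × n` random matrix whose `n²` entries are i.i.d. standard Gaussians. -/
noncomputable def gaussMatrix (n : ℕ) : Measure (Fin n → Fin n → ℝ) :=
  Measure.pi fun _ : Fin n => Measure.pi fun _ : Fin n => gaussianReal 0 1

/-- The squared Frobenius norm of a real `n × n` matrix. -/
noncomputable def frobSq {n : ℕ} (A : Fin n → Fin n → ℝ) : ℝ := ∑ i, ∑ j, A i j ^ 2

/-- The matrix `G(x)` with entries `G(x)_{ij} = c_{x(i)} - c_{x(j)}`. -/
noncomputable def Gmat {n k : ℕ} (c : Fin k → ℝ) (x : Fin n → Fin k) : Fin n → Fin n → ℝ :=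
  fun i j => c (x i) - c (x j)

/-- The number of vertices to which `x` assigns color `i`. -/
def colorCard {n k : ℕ} (x : Fin n → Fin k) (i : Fin k) : ℕ :=
  (Finset.univ.filter fun v => x v = i).card

instance (n : ℕ) : IsProbabilityMeasure (gaussMatrix n) := by
  unfold gaussMatrix; infer_instance

lemma exp_sum_sum_eq_prod {n : ℕ} (b : Fin n → Fin n → ℝ) (t : ℝ) :
    (fun W : Fin n → Fin n → ℝ => Real.exp (t * ∑ i, ∑ j, b i j * W i j)) =
      fun W => ∏ i, ∏ j, Real.exp (t * b i j * W i j) := by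
  funext W
  simp only [← Real.exp_sum, mul_sum, mul_assoc]

lemma integrable_exp_gaussMatrix {n : ℕ} (b : Fin n → Fin n → ℝ) (t : ℝ) :
    Integrable (fun W => Real.exp (t * ∑ i, ∑ j, b i j * W i j)) (gaussMatrix n) := by
  rw [exp_sum_sum_eq_prod, gaussMatrix]
  have h (i : Fin n) : Integrable (fun w : Fin n → ℝ => ∏ j, Real.exp (t * b i j * w j))
      (Measure.pi fun _ => gaussianReal 0 1) :=
    Integrable.fintype_prod (𝕜 := ℝ) (f := fun j w => Real.exp (t * b i j * w)) fun j =>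
      integrable_exp_mul_gaussianReal _
  exact Integrable.fintype_prod (𝕜 := ℝ) h

lemma mgf_gaussMatrix {n : ℕ} (b : Fin n → Fin n → ℝ) (t : ℝ) :
    mgf (fun W => ∑ i, ∑ j, b i j * W i j) (gaussMatrix n) t =
      Real.exp (t ^ 2 / 2 * frobSq b) := by
  have h1 (s : ℝ) : ∫ w, Real.exp (s * w) ∂(gaussianReal 0 1) = Real.exp (s ^ 2 / 2) := by
    have := congrFun (mgf_fun_id_gaussianReal (μ := 0) (v := 1)) s
    simpa [mgf] using this
  rw [mgf, exp_sum_sum_eq_prod, gaussMatrix,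
    integral_fintype_prod_eq_prod (fun i (w : Fin n → ℝ) => ∏ j, Real.exp (t * b i j * w j))]
  simp_rw [fun i => integral_fintype_prod_eq_prod (μ := fun _ : Fin n => gaussianReal 0 1)
    (fun j w => Real.exp (t * b i j * w)), h1, ← Real.exp_sum, frobSq, mul_sum]
  congr! 3
  ring

/-- Chernoff bound for the event that a competitor at offset `A` beats the true signal. -/
lemma gaussMatrix_frobSq_le {n : ℕ} (A : Fin n → Fin n → ℝ) (s t : ℝ) (ht : 0 ≤ t)
    (hts : 4 * t * s ^ 2 ≤ 1) :
    (gaussMatrix n).real {W | frobSq (fun i j => A i j + s * W i j) ≤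
        frobSq (fun i j => s * W i j)} ≤ Real.exp (-(t * frobSq A / 2)) := by
  have hset : {W : Fin n → Fin n → ℝ | frobSq (fun i j => A i j + s * W i j) ≤
      frobSq (fun i j => s * W i j)} =
      {W | frobSq A ≤ ∑ i, ∑ j, (-2 * s * A i j) * W i j} := by
    ext W
    have : frobSq (fun i j => A i j + s * W i j) =
        frobSq A - ∑ i, ∑ j, (-2 * s * A i j) * W i j + frobSq (fun i j => s * W i j) := by
      simp only [frobSq, ← sum_sub_distrib, ← sum_add_distrib]
      congr! 2
      ring
    simp only [Set.mem_ofPred_eq, this]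
    constructor <;> intro h <;> linarith
  have hA : 0 ≤ frobSq A := sum_nonneg fun i _ => sum_nonneg fun j _ => sq_nonneg _
  have hb : frobSq (fun i j => -2 * s * A i j) = 4 * s ^ 2 * frobSq A := by
    simp only [frobSq, mul_sum]
    congr! 2
    ring
  rw [hset]
  refine (measure_ge_le_exp_mul_mgf _ ht (integrable_exp_gaussMatrix _ t)).trans ?_
  rw [mgf_gaussMatrix, ← Real.exp_add, hb]
  refine Real.exp_le_exp.2 ?_
  nlinarith [mul_nonneg ht hA]

lemma exists_pos_le_of_pos {ι : Type*} [Finite ι] (f : ι → ℝ) :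
    ∃ γ > 0, ∀ i, 0 < f i → γ ≤ f i := by
  have := Fintype.ofFinite ι
  rcases (univ.filter fun i => 0 < f i).eq_empty_or_nonempty with h | h
  · refine ⟨1, one_pos, fun i hi => ?_⟩
    have : i ∈ univ.filter fun i => 0 < f i := by simpa using hi
    simp [h] at this
  · obtain ⟨i, hi, hmin⟩ := exists_min_image _ f h
    exact ⟨f i, (mem_filter.1 hi).2, fun j hj => hmin j (by simpa using hj)⟩

/-- The minimal squared color gap is positive and bounds every squared gap from below. -/
lemma sInf_sq_gap {k : ℕ} (hk : 2 ≤ k) {c : Fin k → ℝ} (hc : Function.Injective c) :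
    0 < sInf {r : ℝ | ∃ i j : Fin k, i < j ∧ r = (c i - c j) ^ 2} ∧
    ∀ a b, a ≠ b →
      sInf {r : ℝ | ∃ i j : Fin k, i < j ∧ r = (c i - c j) ^ 2} ≤ (c a - c b) ^ 2 := by
  constructor
  · obtain ⟨γ, hγ, h⟩ := exists_pos_le_of_pos fun p : Fin k × Fin k => (c p.1 - c p.2) ^ 2
    refine hγ.trans_le (le_csInf ⟨_, ⟨0, by omega⟩, ⟨1, by omega⟩, by simp, rfl⟩ ?_)
    rintro _ ⟨i, j, hij, rfl⟩
    exact h (i, j) (sq_pos_of_ne_zero (sub_ne_zero.2 (hc.ne hij.ne)))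
  · intro a b hab
    have hbdd : BddBelow {r : ℝ | ∃ i j : Fin k, i < j ∧ r = (c i - c j) ^ 2} :=
      ⟨0, by rintro _ ⟨i, j, -, rfl⟩; positivity⟩
    rcases hab.lt_or_gt with h | h
    · exact csInf_le hbdd ⟨a, b, h, rfl⟩
    · exact csInf_le hbdd ⟨b, a, h, by ring⟩

lemma sum_sum_sub_sq {n : ℕ} (u : Fin n → ℝ) :
    ∑ i, ∑ j, (u i - u j) ^ 2 = 2 * n * ∑ i, u i ^ 2 - 2 * (∑ i, u i) ^ 2 := by
  have : ∀ i j, (u i - u j) ^ 2 = u i ^ 2 + u j ^ 2 - 2 * (u i * u j) := fun i j => by ring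
  simp only [this, sum_sub_distrib, sum_add_distrib, sum_const, ← mul_sum, ← sum_mul, card_univ,
    Fintype.card_fin, nsmul_eq_mul]
  ring

lemma frobSq_Gmat_sub {n k : ℕ} (c : Fin k → ℝ) (x y : Fin n → Fin k) :
    frobSq (fun i j => Gmat c y i j - Gmat c x i j) =
      ∑ i, ∑ j, ((c (y i) - c (x i)) - (c (y j) - c (x j))) ^ 2 := by
  simp only [frobSq, Gmat]
  congr! 2
  ring

/-- Separation of `G(x)` and `G(y)` when `x` and `y` differ in few vertices. -/
lemma frobSq_Gmat_sub_ge {n k : ℕ} (c : Fin k → ℝ) {C : ℝ}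
    (hgap : ∀ a b, a ≠ b → C ≤ (c a - c b) ^ 2) (x y : Fin n → Fin k) :
    2 * (n - hammingDist y x) * (hammingDist y x * C) ≤
      frobSq (fun i j => Gmat c y i j - Gmat c x i j) := by
  rw [frobSq_Gmat_sub, sum_sum_sub_sq]
  set S := univ.filter fun i => y i ≠ x i
  have hS : hammingDist y x = #S := rfl
  have hres (f : ℝ → ℝ) (hf : f 0 = 0) :
      ∑ i, f (c (y i) - c (x i)) = ∑ i ∈ S, f (c (y i) - c (x i)) := by
    refine (sum_subset (subset_univ _) fun i _ hi => ?_).symm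
    have : y i = x i := by simpa [S] using hi
    simp [this, hf]
  rw [hres (fun t => t ^ 2) (by simp), hres (fun t => t) rfl, hS]
  have h1 := sq_sum_le_card_mul_sum_sq (s := S) (f := fun i => c (y i) - c (x i))
  have h2 : #S * C ≤ ∑ i ∈ S, (c (y i) - c (x i)) ^ 2 := by
    rw [← nsmul_eq_mul]
    exact card_nsmul_le_sum _ _ _ fun i hi => hgap _ _ (mem_filter.1 hi).2
  have h3 : (#S : ℝ) ≤ n := by
    exact_mod_cast (card_le_univ S).trans_eq (Fintype.card_fin n)
  nlinarith [mul_le_mul_of_nonneg_left h2 (sub_nonneg.2 h3)]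

/-- Separation of `G(x)` and `G(y)` when `x` and `y` differ in many vertices and every color class
of `y` is large. -/
lemma le_frobSq_Gmat_sub_of_le_hammingDist {n k : ℕ} {c : Fin k → ℝ}
    (hc : Function.Injective c) {γ η : ℝ} (hγ : 0 ≤ γ)
    (hgap : ∀ a b d e, (c a - c b) ≠ (c d - c e) → γ ≤ ((c a - c b) - (c d - c e)) ^ 2)
    (x y : Fin n → Fin k) (hcls : ∀ a, η * n ≤ colorCard y a) (hd : η * n ≤ hammingDist y x) :
    γ * η * n ^ 2 ≤ frobSq (fun i j => Gmat c y i j - Gmat c x i j) := by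
  rw [frobSq_Gmat_sub]
  have key (i : Fin n) :
      γ * (η * n) ≤ ∑ j, ((c (y i) - c (x i)) - (c (y j) - c (x j))) ^ 2 := by
    obtain ⟨S, hS, hne⟩ : ∃ S : Finset (Fin n), η * n ≤ #S ∧
        ∀ j ∈ S, c (y i) - c (x i) ≠ c (y j) - c (x j) := by
      have : Nonempty (Fin k) := ⟨y i⟩
      rcases lt_trichotomy (c (y i) - c (x i)) 0 with h | h | h
      · obtain ⟨a, ha⟩ := Finite.exists_max c
        refine ⟨univ.filter fun j => y j = a, hcls a, fun j hj => ?_⟩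
        rw [(mem_filter.1 hj).2]
        exact ne_of_lt (by linarith [ha (x j)])
      · refine ⟨univ.filter fun j => y j ≠ x j, hd, fun j hj => ?_⟩
        rw [h]
        exact fun h0 => (mem_filter.1 hj).2 (hc (sub_eq_zero.1 h0.symm))
      · obtain ⟨a, ha⟩ := Finite.exists_min c
        refine ⟨univ.filter fun j => y j = a, hcls a, fun j hj => ?_⟩
        rw [(mem_filter.1 hj).2]
        exact ne_of_gt (by linarith [ha (x j)])
    calc γ * (η * n) ≤ #S * γ := by nlinarith
      _ ≤ ∑ j ∈ S, ((c (y i) - c (x i)) - (c (y j) - c (x j))) ^ 2 := by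
        rw [← nsmul_eq_mul]
        exact card_nsmul_le_sum _ _ _ fun j hj => hgap _ _ _ _ (hne j hj)
      _ ≤ _ := sum_le_univ_sum_of_nonneg fun j => sq_nonneg _
  calc γ * η * n ^ 2 = ∑ _i : Fin n, γ * (η * n) := by
        simp; ring
    _ ≤ _ := sum_le_sum fun i _ => key i

lemma sum_pow_hammingDist_le {n k : ℕ} (y : Fin n → Fin k) {q : ℝ} (hq : 0 ≤ q) :
    ∑ x, q ^ hammingDist y x ≤ (1 + k * q) ^ n := by
  have hprod (x : Fin n → Fin k) :
      q ^ hammingDist y x = ∏ i, if y i = x i then 1 else q := by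
    rw [hammingDist, ← prod_const, prod_filter]
    exact prod_congr rfl fun i _ => by by_cases h : y i = x i <;> simp [h]
  simp_rw [hprod]
  rw [← Fintype.piFinset_univ,
    ← prod_univ_sum (fun _ => univ) (fun i a => if y i = a then (1 : ℝ) else q)]
  calc ∏ i, ∑ a, (if y i = a then 1 else q) ≤ ∏ _i : Fin n, (1 + k * q) := by
        refine prod_le_prod (fun i _ => sum_nonneg fun a _ => by positivity) fun i _ => ?_
        calc ∑ a, (if y i = a then 1 else q) ≤ ∑ a, ((if y i = a then 1 else 0) + q) :=
              sum_le_sum fun a _ => by split_ifs <;> linarith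
          _ = 1 + k * q := by simp [sum_add_distrib]
    _ = (1 + k * q) ^ n := by simp

/-- Probability that a fixed competitor `x` is at least as good as the true assignment `y`. -/
lemma gaussMatrix_competitor_le {n k : ℕ} (hn : 2 ≤ n) {c : Fin k → ℝ}
    (hc : Function.Injective c) {C γ η δ s : ℝ} (hC : 0 < C)
    (hCgap : ∀ a b, a ≠ b → C ≤ (c a - c b) ^ 2) (hγ : 0 ≤ γ)
    (hγgap : ∀ a b d e, (c a - c b) ≠ (c d - c e) → γ ≤ ((c a - c b) - (c d - c e)) ^ 2)
    (hδ : 0 < δ) (hδ1 : δ < 1) (hηδ : η ≤ δ / 2)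
    (hs : s ^ 2 < (1 - δ) * n * C / (4 * Real.log n))
    (x y : Fin n → Fin k) (hcls : ∀ a, η * n ≤ colorCard y a) :
    (gaussMatrix n).real
        {W | frobSq (fun i j => (Gmat c y i j + s * W i j) - Gmat c x i j) ≤
          frobSq (fun i j => (Gmat c y i j + s * W i j) - Gmat c y i j)} ≤
      Real.exp (-((1 + δ / 2) * Real.log n)) ^ hammingDist y x +
        Real.exp (-(γ * η / (2 * (1 - δ) * C) * Real.log n)) ^ n := by
  have hn0 : (0 : ℝ) < n := by exact_mod_cast (by omega : 0 < n)
  have hlog : 0 < Real.log n := Real.log_pos (by exact_mod_cast (by omega : 1 < n))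
  have hδ' : 0 < 1 - δ := by linarith
  set B := (1 - δ) * n * C with hB
  have hBpos : 0 < B := by positivity
  set A : Fin n → Fin n → ℝ := fun i j => Gmat c y i j - Gmat c x i j
  have hset : {W : Fin n → Fin n → ℝ |
      frobSq (fun i j => (Gmat c y i j + s * W i j) - Gmat c x i j) ≤
        frobSq (fun i j => (Gmat c y i j + s * W i j) - Gmat c y i j)} =
      {W | frobSq (fun i j => A i j + s * W i j) ≤ frobSq (fun i j => s * W i j)} := by
    simp only [A, add_sub_cancel_left, add_sub_right_comm]
  have hts : 4 * (Real.log n / B) * s ^ 2 ≤ 1 := by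
    rw [lt_div_iff₀ (by positivity)] at hs
    rw [mul_div_assoc', div_mul_eq_mul_div, div_le_one hBpos]
    linarith
  rw [hset]
  refine (gaussMatrix_frobSq_le A s (Real.log n / B) (by positivity) hts).trans ?_
  rcases le_total (hammingDist y x : ℝ) (η * n) with hd | hd
  · refine le_add_of_le_of_nonneg ?_ (by positivity)
    rw [← Real.exp_nat_mul, Real.exp_le_exp]
    have h1 := frobSq_Gmat_sub_ge c hCgap x y
    have h2 : 2 * ((1 - δ / 2) * n) * (hammingDist y x * C) ≤ frobSq A := by
      refine le_trans ?_ h1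
      gcongr
      nlinarith
    have h3 : (1 + δ / 2) * hammingDist y x ≤ frobSq A / (2 * B) := by
      rw [le_div_iff₀ (by positivity)]
      refine le_trans ?_ h2
      have : (1 + δ / 2) * (1 - δ) ≤ 1 - δ / 2 := by nlinarith
      have := mul_le_mul_of_nonneg_right this
        (by positivity : 0 ≤ 2 * n * (hammingDist y x * C))
      rw [hB]
      linarith
    have h4 := mul_le_mul_of_nonneg_left h3 hlog.le
    have h5 : Real.log n / B * frobSq A / 2 = Real.log n * (frobSq A / (2 * B)) := by
      field_simp
    rw [h5]
    linarith
  · refine le_add_of_nonneg_of_le (by positivity) ?_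
    rw [← Real.exp_nat_mul, Real.exp_le_exp]
    have h1 := le_frobSq_Gmat_sub_of_le_hammingDist hc hγ hγgap x y hcls hd
    have h2 : Real.log n / B * (γ * η * n ^ 2) / 2 ≤ Real.log n / B * frobSq A / 2 := by
      gcongr
    have h3 : Real.log n / B * (γ * η * n ^ 2) / 2 =
        n * (γ * η / (2 * (1 - δ) * C) * Real.log n) := by
      rw [hB]
      field_simp
    linarith

lemma tendsto_gaussMatrix_one {S : (n : ℕ) → Set (Fin n → Fin n → ℝ)} {b : ℕ → ℝ}
    (hb : Tendsto b atTop (nhds 0)) (h : ∀ᶠ n in atTop, (gaussMatrix n).real (S n)ᶜ ≤ b n) :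
    Tendsto (fun n => gaussMatrix n (S n)) atTop (nhds 1) := by
  have hreal : Tendsto (fun n => (gaussMatrix n).real (S n)) atTop (nhds 1) := by
    have hb1 : Tendsto (fun n => 1 - b n) atTop (nhds 1) := by
      simpa using hb.const_sub 1
    refine tendsto_of_tendsto_of_tendsto_of_le_of_le' hb1 tendsto_const_nhds ?_
      (Eventually.of_forall fun n => measureReal_le_one)
    filter_upwards [h] with n hn
    have := measureReal_union_le (μ := gaussMatrix n) (S n) (S n)ᶜ
    rw [Set.union_compl_self, probReal_univ] at this
    linarith
  simpa [ofReal_measureReal] using ENNReal.tendsto_ofReal hreal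

lemma tendsto_exp_neg_mul_log {a : ℝ} (ha : 0 < a) :
    Tendsto (fun n : ℕ => Real.exp (-(a * Real.log n))) atTop (nhds 0) :=
  Real.tendsto_exp_neg_atTop_nhds_zero.comp
    ((Real.tendsto_log_atTop.comp tendsto_natCast_atTop_atTop).const_mul_atTop ha)

theorem exact_recovery_G_subcritical
    (k : ℕ) (hk : 2 ≤ k) (c : Fin k → ℝ) (hc : Function.Injective c)
    (C0 : ℝ)
    (hC0 : C0 = sInf {r : ℝ | ∃ i j : Fin k, i < j ∧ r = (c i - c j) ^ 2})
    (nn : ℕ → Fin k → ℕ)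
    (hmono : ∀ n : ℕ, ∀ i j : Fin k, i ≤ j → nn n j ≤ nn n i)
    (hpos : ∀ n : ℕ, k ≤ n → ∀ i : Fin k, 0 < nn n i)
    (hsum : ∀ n : ℕ, k ≤ n → ∑ i, nn n i = n)
    (cl : ℝ) (hcl : 0 < cl)
    (hlow : ∀ n : ℕ, k ≤ n → cl * n ≤ (nn n ⟨k - 1, by omega⟩ : ℝ))
    (y : (n : ℕ) → Fin n → Fin k)
    (hy : ∀ n : ℕ, k ≤ n → ∀ i : Fin k, colorCard (y n) i = nn n i)
    (σ : ℕ → ℝ) (δ : ℝ) (hδ : 0 < δ)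
    (hσ : ∀ n : ℕ, k ≤ n → σ n ^ 2 < (1 - δ) * n * C0 / (4 * Real.log n)) :
    Tendsto (fun n : ℕ => gaussMatrix n
        {W | ∀ x : Fin n → Fin k, (∀ i, colorCard x i = nn n i) → x ≠ y n →
          frobSq (fun i j => (Gmat c (y n) i j + σ n * W i j) - Gmat c (y n) i j) <
          frobSq (fun i j => (Gmat c (y n) i j + σ n * W i j) - Gmat c x i j)})
      atTop (nhds 1) ∧
    Tendsto (fun n : ℕ => gaussMatrix n
        {W | ∀ x : Fin n → Fin k, x ≠ y n →
          frobSq (fun i j => (Gmat c (y n) i j + σ n * W i j) - Gmat c (y n) i j) <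
          frobSq (fun i j => (Gmat c (y n) i j + σ n * W i j) - Gmat c x i j)})
      atTop (nhds 1) := by
  obtain ⟨hC0pos, hCgap⟩ := sInf_sq_gap hk hc
  rw [← hC0] at hC0pos hCgap
  have hδ1 : δ < 1 := by
    by_contra! h
    have h1 := hσ k le_rfl
    have hlog : 0 ≤ Real.log k := Real.log_natCast_nonneg k
    have h2 : (1 - δ) * k * C0 / (4 * Real.log k) ≤ 0 := by
      refine div_nonpos_of_nonpos_of_nonneg ?_ (by positivity)
      rw [mul_assoc]
      exact mul_nonpos_of_nonpos_of_nonneg (by linarith) (by positivity)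
    linarith [sq_nonneg (σ k)]
  obtain ⟨γ, hγ, hγgap⟩ := exists_pos_le_of_pos
    fun p : (Fin k × Fin k) × Fin k × Fin k =>
      ((c p.1.1 - c p.1.2) - (c p.2.1 - c p.2.2)) ^ 2
  obtain ⟨η, hη, hηδ, hηcl⟩ : ∃ η > 0, η ≤ δ / 2 ∧ η ≤ cl :=
    ⟨min (δ / 2) cl, by positivity, min_le_left _ _, min_le_right _ _⟩
  set κ := γ * η / (2 * (1 - δ) * C0)
  have hκ : 0 < κ := by
    have : 0 < 1 - δ := by linarith
    positivity
  have hr := (tendsto_exp_neg_mul_log hκ).const_mul (k : ℝ)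
  have hq := (tendsto_exp_neg_mul_log (half_pos hδ)).const_mul (k : ℝ)
  rw [mul_zero] at hr hq
  have hb := (((Real.continuous_exp.tendsto 0).comp hq).sub_const 1).add hr
  rw [Real.exp_zero, sub_self, add_zero] at hb
  have main : ∀ᶠ n : ℕ in atTop, (gaussMatrix n).real
      {W | ∀ x : Fin n → Fin k, x ≠ y n →
          frobSq (fun i j => (Gmat c (y n) i j + σ n * W i j) - Gmat c (y n) i j) <
          frobSq (fun i j => (Gmat c (y n) i j + σ n * W i j) - Gmat c x i j)}ᶜ ≤
      Real.exp (k * Real.exp (-(δ / 2 * Real.log n))) - 1 +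
        k * Real.exp (-(κ * Real.log n)) := by
    filter_upwards [eventually_ge_atTop k, hr.eventually (eventually_le_nhds one_pos)]
      with n hkn hrn
    have hn : 2 ≤ n := hk.trans hkn
    have hn0 : (0 : ℝ) < n := by exact_mod_cast (by omega : 0 < n)
    have hcls (a : Fin k) : η * n ≤ colorCard (y n) a := by
      have h1 : nn n ⟨k - 1, by omega⟩ ≤ nn n a := hmono n _ _ (Fin.le_def.2 (by
        have := a.isLt
        show (a : ℕ) ≤ k - 1
        omega))
      rw [hy n hkn]
      calc η * n ≤ cl * n := by gcongr
        _ ≤ _ := hlow n hkn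
        _ ≤ _ := by exact_mod_cast h1
    set q := Real.exp (-((1 + δ / 2) * Real.log n)) with hqdef
    set r := Real.exp (-(κ * Real.log n))
    have hnq : n * q = Real.exp (-(δ / 2 * Real.log n)) := by
      nth_rewrite 1 [← Real.exp_log hn0]
      rw [hqdef, ← Real.exp_add]
      ring_nf
    calc _ ≤ (gaussMatrix n).real (⋃ x ∈ univ.erase (y n),
          {W | frobSq (fun i j => (Gmat c (y n) i j + σ n * W i j) - Gmat c x i j) ≤
            frobSq (fun i j => (Gmat c (y n) i j + σ n * W i j) - Gmat c (y n) i j)}) := by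
          refine measureReal_mono (fun W hW => ?_) (measure_ne_top _ _)
          simp only [Set.mem_compl_iff, Set.mem_ofPred_eq, not_forall, not_lt] at hW
          obtain ⟨x, hx, h⟩ := hW
          exact Set.mem_biUnion (mem_coe.2 (mem_erase.2 ⟨hx, mem_univ x⟩)) h
      _ ≤ ∑ x ∈ univ.erase (y n), (q ^ hammingDist (y n) x + r ^ n) :=
          (measureReal_biUnion_finset_le _ _).trans (sum_le_sum fun x _ =>
            gaussMatrix_competitor_le hn hc hC0pos hCgap hγ.le
              (fun a b d e h => hγgap ((a, b), (d, e)) (sq_pos_of_ne_zero (sub_ne_zero.2 h)))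
              hδ hδ1 hηδ (hσ n hkn) x (y n) hcls)
      _ ≤ (∑ x, q ^ hammingDist (y n) x - 1) + ∑ _x : Fin n → Fin k, r ^ n := by
          rw [sum_add_distrib]
          gcongr
          · rw [← add_sum_erase univ _ (mem_univ (y n))]
            simp
          · exact erase_subset _ _
      _ ≤ ((1 + k * q) ^ n - 1) + (k * r) ^ n := by
          gcongr
          · exact sum_pow_hammingDist_le (y n) (Real.exp_pos _).le
          · simp [mul_pow]
      _ ≤ _ := by
          gcongr
          · calc (1 + k * q) ^ n ≤ Real.exp (k * q) ^ n := by
                  gcongr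
                  linarith [Real.add_one_le_exp (k * q)]
              _ = Real.exp (k * (n * q)) := by
                  rw [← Real.exp_nat_mul]
                  ring_nf
              _ = _ := by rw [hnq]
          · exact pow_le_of_le_one (by positivity) hrn (by omega)
  refine ⟨tendsto_gaussMatrix_one hb (main.mono fun n hn => le_trans ?_ hn),
    tendsto_gaussMatrix_one hb main⟩
  exact measureReal_mono (Set.compl_subset_compl.2 fun W hW x _ hx => hW x hx)
end

section
/- Fix an integer k ≥ 2 and distinct real numbers c_1,…,c_k, and set C_0 = min_{1≤i<j≤k}(c_i−c_j)². For each n, let n_1(n) ≥ … ≥ n_k(n) be positive integers summing to n, and assume there is a constant c > 0 (independent of n) with n_k(n) ≥ c·n for all n. Let y_n ∈ Ω_{n_1(n),…,n_k(n)} be the true color assignment and T_n = G(y_n) + σ_n W_n the observation. If there is a constant δ > 0 (independent of n) such that σ_n² > (1+δ)·n·C_0/(4 log n) for all n, then as n → ∞ both of the following probabilities tend to 0: (i) the probability that y_n is the unique minimizer of ‖T_n − G(x)‖_F² over x ∈ Ω_{n_1(n),…,n_k(n)}; (ii) the probability that y_n is the unique minimizer of ‖T_n − G(x)‖_F² over x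 ∈ Ω. -/
open MeasureTheory ProbabilityTheory Filter Finset

/-- The combinations of independent standard Gaussians given by an orthonormal family of
coefficient vectors are again independent standard Gaussians. -/
lemma iIndepFun_and_hasLaw_of_orthonormal {Ω κ ι : Type*} [MeasurableSpace Ω] [Fintype κ]
    [Fintype ι] [DecidableEq ι] {P : Measure Ω} {X : κ → Ω → ℝ} (hX : iIndepFun X P)
    (hlaw : ∀ p, HasLaw (X p) (gaussianReal 0 1) P) (a : ι → κ → ℝ)
    (ha : ∀ u w, ∑ p, a u p * a w p = if u = w then 1 else 0) :
    iIndepFun (fun u ω => ∑ p, a u p * X p ω) P ∧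
      ∀ u, HasLaw (fun ω => ∑ p, a u p * X p ω) (gaussianReal 0 1) P := by
  classical
  have hXg : ∀ p, HasGaussianLaw (X p) P := fun p => (hlaw p).hasGaussianLaw
  have := hX.isProbabilityMeasure
  have hjoint : HasGaussianLaw (fun ω => (X · ω)) P := iIndepFun.hasGaussianLaw hXg hX
  let L : (κ → ℝ) →L[ℝ] (ι → ℝ) :=
    ContinuousLinearMap.pi fun u => ∑ p, a u p • ContinuousLinearMap.proj (R := ℝ) p
  have hH : HasGaussianLaw (fun ω => ((fun u ω => ∑ p, a u p * X p ω) · ω : ι → ℝ)) P := by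
    have hL : (fun ω => ((fun u ω => ∑ p, a u p * X p ω) · ω : ι → ℝ)) =
        fun ω => L (X · ω) := by
      ext ω u
      simp [L]
    rw [hL]
    exact hjoint.map_fun L
  have hcovX : ∀ p q, cov[X p, X q; P] = if p = q then 1 else 0 := by
    intro p q
    split_ifs with hpq
    · subst hpq
      rw [covariance_self (hXg p).aemeasurable, (hlaw p).variance_eq]
      simp
    · exact (hX.indepFun hpq).covariance_eq_zero (hXg p).memLp_two (hXg q).memLp_two
  have hcov : ∀ u w, cov[fun ω => ∑ p, a u p * X p ω, fun ω => ∑ p, a w p * X p ω; P]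
      = if u = w then 1 else 0 := by
    intro u w
    rw [covariance_fun_sum_fun_sum (fun p => (hXg p).memLp_two.const_mul _)
      (fun p => (hXg p).memLp_two.const_mul _), ← ha u w]
    simp [covariance_const_mul_left, covariance_const_mul_right, hcovX]
    exact Finset.sum_congr rfl fun p _ => mul_comm _ _
  refine ⟨hH.iIndepFun_of_covariance_eq_zero fun u w huw => by rw [hcov, if_neg huw], fun u => ?_⟩
  have hu := hH.eval u
  refine ⟨hu.aemeasurable, ?_⟩
  rw [hu.map_eq_gaussianReal, ← covariance_self hu.aemeasurable, hcov,
    integral_finsetSum _ fun p _ => (hXg p).integrable.const_mul _]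
  simp [integral_const_mul, (hlaw _).integral_eq]

lemma iIndepFun_gaussMatrix (n : ℕ) :
    iIndepFun (fun (p : Fin n × Fin n) (W : Fin n → Fin n → ℝ) => W p.1 p.2) (gaussMatrix n) := by
  have h := iIndepFun_uncurry_infinitePi' (X := fun (_ _ : Fin n) (x : ℝ) => x)
    (fun _ _ : Fin n => gaussianReal 0 1) (fun _ _ => measurable_id)
  simpa only [Measure.infinitePi_eq_pi, gaussMatrix] using h

instance isProbabilityMeasure_gaussMatrix (n : ℕ) : IsProbabilityMeasure (gaussMatrix n) := by
  unfold gaussMatrix; infer_instance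

lemma hasLaw_gaussMatrix_apply {n : ℕ} (i j : Fin n) :
    HasLaw (fun W : Fin n → Fin n → ℝ => W i j) (gaussianReal 0 1) (gaussMatrix n) := by
  refine ⟨((measurable_pi_apply j).comp (measurable_pi_apply i)).aemeasurable, ?_⟩
  have h1 := measurePreserving_eval
    (fun _ : Fin n => Measure.pi fun _ : Fin n => gaussianReal 0 1) i
  have h2 := measurePreserving_eval (fun _ : Fin n => gaussianReal 0 1) j
  exact (h2.comp h1).map_eq

/-- The row-minus-column sum at `v`, shifted by a multiple of a diagonal entry that makes these
statistics uncorrelated for different `v`, and normalised to unit variance. -/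
noncomputable def vertexStat {n : ℕ} (o v : Fin n) (W : Fin n → Fin n → ℝ) : ℝ :=
  (√(2 * n))⁻¹ * (∑ j, (W v j - W j v) + √2 * W o o)

/-- The coefficient of the matrix entry `p` in `vertexStat o v`. -/
noncomputable def vertexCoeff {n : ℕ} (o v : Fin n) (p : Fin n × Fin n) : ℝ :=
  (√(2 * n))⁻¹ * ((if p.1 = v then 1 else 0) - (if p.2 = v then 1 else 0)
    + √2 * ((if p.1 = o then 1 else 0) * (if p.2 = o then 1 else 0)))

lemma vertexStat_eq {n : ℕ} (o v : Fin n) (W : Fin n → Fin n → ℝ) :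
    vertexStat o v W = ∑ p : Fin n × Fin n, vertexCoeff o v p * W p.1 p.2 := by
  simp only [vertexStat, vertexCoeff, mul_assoc, ← Finset.mul_sum]
  congr 1
  simp [Fintype.sum_prod_type, add_mul, sub_mul, Finset.sum_add_distrib, Finset.sum_sub_distrib]

lemma sum_vertexCoeff_mul {n : ℕ} (o u w : Fin n) :
    ∑ p, vertexCoeff o u p * vertexCoeff o w p = if u = w then 1 else 0 := by
  have hn : (0 : ℝ) < n := by exact_mod_cast o.pos
  have h2 : √(2 * (n : ℝ)) ^ 2 = 2 * n := Real.sq_sqrt (by positivity)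
  have h3 : √2 * √2 = (2 : ℝ) := Real.mul_self_sqrt (by norm_num)
  let e (v i : Fin n) : ℝ := if i = v then 1 else 0
  have hcomb : ∑ p : Fin n × Fin n,
      (e u p.1 - e u p.2 + √2 * (e o p.1 * e o p.2)) *
        (e w p.1 - e w p.2 + √2 * (e o p.1 * e o p.2)) = if u = w then 2 * (n : ℝ) else 0 := by
    have hs (v : Fin n) : ∑ i, e v i = 1 := by simp [e]
    have hss (v v' : Fin n) : ∑ i, e v i * e v' i = if v = v' then 1 else 0 := by
      simp [e, eq_comm]
    have hns (v v' : Fin n) : ∑ i, e v i * (n * e v' i) = if v = v' then (n : ℝ) else 0 := by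
      simp [e, eq_comm]
    have hexp : ∀ i j : Fin n, (e u i - e u j + √2 * (e o i * e o j)) *
        (e w i - e w j + √2 * (e o i * e o j)) =
        e u i * e w i + e u j * e w j - e u i * e w j - e w i * e u j
        + √2 * ((e u i * e o i) * e o j - e o i * (e u j * e o j)
          + (e w i * e o i) * e o j - e o i * (e w j * e o j))
        + 2 * ((e o i * e o i) * (e o j * e o j)) := by
      intro i j
      linear_combination (e o i * e o i) * (e o j * e o j) * h3
    rw [Fintype.sum_prod_type]
    simp only [hexp, Finset.sum_add_distrib, Finset.sum_sub_distrib, ← Finset.mul_sum,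
      ← Finset.sum_mul, hs, hss, hns, Finset.sum_const, Finset.card_univ, Fintype.card_fin, nsmul_eq_mul]
    split_ifs <;> ring
  have : ∀ p, vertexCoeff o u p * vertexCoeff o w p = (2 * (n : ℝ))⁻¹ *
      ((e u p.1 - e u p.2 + √2 * (e o p.1 * e o p.2)) *
        (e w p.1 - e w p.2 + √2 * (e o p.1 * e o p.2))) := by
    intro p
    rw [← h2]
    simp only [vertexCoeff, e]
    ring
  simp only [this, ← Finset.mul_sum, hcomb]
  split_ifs
  · field_simp
  · simp

lemma gaussianReal_Iio_le {s : ℝ} (hs : 0 ≤ s) :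
    gaussianReal 0 1 (Set.Iio s) ≤
      ENNReal.ofReal (1 - (√(2 * Real.pi))⁻¹ * Real.exp (-(s + 1) ^ 2 / 2)) := by
  set q := (√(2 * Real.pi))⁻¹ * Real.exp (-(s + 1) ^ 2 / 2) with hq
  have hlow : ENNReal.ofReal q ≤ gaussianReal 0 1 (Set.Ici s) := by
    calc ENNReal.ofReal q = ENNReal.ofReal (∫ _ in Set.Icc s (s + 1), q) := by simp
      _ ≤ ENNReal.ofReal (∫ x in Set.Icc s (s + 1), gaussianPDFReal 0 1 x) := by
        refine ENNReal.ofReal_le_ofReal ?_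
        refine setIntegral_mono_on (by simp) (integrable_gaussianPDFReal _ _).integrableOn
          measurableSet_Icc fun x hx => ?_
        rw [gaussianPDFReal_def, hq]
        simp only [NNReal.coe_one, mul_one, sub_zero]
        have h1 := hx.1
        have h2 := hx.2
        gcongr
        linarith
      _ = gaussianReal 0 1 (Set.Icc s (s + 1)) :=
        (gaussianReal_apply_eq_integral 0 one_ne_zero _).symm
      _ ≤ gaussianReal 0 1 (Set.Ici s) := measure_mono Set.Icc_subset_Ici_self
  have hq0 : 0 ≤ q := by positivity
  rw [← Set.compl_Ici, prob_compl_eq_one_sub measurableSet_Ici, ENNReal.ofReal_sub _ hq0,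
    ENNReal.ofReal_one]
  gcongr

/-- With `τ = ±1`, the probability that all of `τ * vertexStat o v`, `v ∈ B`, stay below `s`. -/
lemma gaussMatrix_forall_lt_le {n : ℕ} (o : Fin n) {τ : ℝ} (hτ : τ * τ = 1) (B : Finset (Fin n))
    {s : ℝ} (hs : 0 ≤ s) :
    gaussMatrix n {W | ∀ v ∈ B, τ * vertexStat o v W < s} ≤
      ENNReal.ofReal
        (Real.exp (-((√(2 * Real.pi))⁻¹ * Real.exp (-(s + 1) ^ 2 / 2) * B.card))) := by
  set q := (√(2 * Real.pi))⁻¹ * Real.exp (-(s + 1) ^ 2 / 2) with hq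
  have horth : ∀ u w, ∑ p, (τ * vertexCoeff o u p) * (τ * vertexCoeff o w p)
      = if u = w then 1 else 0 := by
    intro u w
    rw [← sum_vertexCoeff_mul o u w]
    exact Finset.sum_congr rfl fun p _ => by
      linear_combination vertexCoeff o u p * vertexCoeff o w p * hτ
  have hstat : ∀ v W, ∑ p : Fin n × Fin n, τ * vertexCoeff o v p * W p.1 p.2
      = τ * vertexStat o v W := by
    intro v W
    rw [vertexStat_eq, Finset.mul_sum]
    exact Finset.sum_congr rfl fun p _ => by ring
  obtain ⟨hind, hlaw⟩ := iIndepFun_and_hasLaw_of_orthonormal (iIndepFun_gaussMatrix n)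
    (fun p => hasLaw_gaussMatrix_apply p.1 p.2) (fun v p => τ * vertexCoeff o v p) horth
  simp only [hstat] at hind hlaw
  have hset : {W | ∀ v ∈ B, τ * vertexStat o v W < s}
      = ⋂ v ∈ B, (fun W => τ * vertexStat o v W) ⁻¹' Set.Iio s := by
    ext W; simp
  have hq1 : 1 - q ≤ Real.exp (-q) := by linarith [Real.add_one_le_exp (-q)]
  calc gaussMatrix n {W | ∀ v ∈ B, τ * vertexStat o v W < s}
      = ∏ v ∈ B, gaussianReal 0 1 (Set.Iio s) := by
        rw [hset, hind.measure_inter_preimage_eq_mul B fun _ _ => measurableSet_Iio]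
        refine Finset.prod_congr rfl fun v _ => ?_
        rw [← (hlaw v).map_eq, Measure.map_apply_of_aemeasurable (hlaw v).aemeasurable
          measurableSet_Iio]
    _ ≤ ∏ v ∈ B, ENNReal.ofReal (Real.exp (-q)) := by
        gcongr
        exact (gaussianReal_Iio_le hs).trans (ENNReal.ofReal_le_ofReal hq1)
    _ = ENNReal.ofReal (Real.exp (-(q * B.card))) := by
        rw [Finset.prod_const, ← ENNReal.ofReal_pow (Real.exp_pos _).le, ← Real.exp_nat_mul]
        congr 2
        ring

lemma frobSq_add_sub {n : ℕ} (A D : Fin n → Fin n → ℝ) :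
    frobSq (fun i j => A i j + D i j) - frobSq A
      = 2 * ∑ i, ∑ j, A i j * D i j + ∑ i, ∑ j, D i j ^ 2 := by
  simp only [frobSq, Finset.mul_sum, ← Finset.sum_add_distrib, ← Finset.sum_sub_distrib]
  exact Finset.sum_congr rfl fun i _ => Finset.sum_congr rfl fun j _ => by ring

lemma sum_mul_sub_eq {n : ℕ} (W : Fin n → Fin n → ℝ) (d : Fin n → ℝ) :
    ∑ i, ∑ j, W i j * (d i - d j) = ∑ i, d i * ∑ j, (W i j - W j i) := by
  simp only [mul_sub, Finset.mul_sum, Finset.sum_sub_distrib]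
  congr 1
  · exact Finset.sum_congr rfl fun i _ => Finset.sum_congr rfl fun j _ => mul_comm _ _
  · rw [Finset.sum_comm]
    exact Finset.sum_congr rfl fun i _ => Finset.sum_congr rfl fun j _ => mul_comm _ _

lemma sum_sub_sq_eq {n : ℕ} (d : Fin n → ℝ) :
    ∑ i, ∑ j, (d i - d j) ^ 2 = 2 * n * ∑ i, d i ^ 2 - 2 * (∑ i, d i) ^ 2 := by
  simp only [sub_sq, Finset.sum_add_distrib, Finset.sum_sub_distrib, Finset.sum_const,
    Finset.card_univ, Fintype.card_fin, nsmul_eq_mul, mul_assoc, ← Finset.mul_sum,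
    ← Finset.sum_mul]
  ring

/-- If the truth beats the assignment obtained by swapping the colors of `u` and `v`, then the
statistics at `u` and `v` are not too far apart. -/
lemma vertexStat_of_swap {n k : ℕ} (c : Fin k → ℝ) (y : Fin n → Fin k) (o u v : Fin n)
    (huv : u ≠ v) (σ : ℝ) (W : Fin n → Fin n → ℝ)
    (h : frobSq (fun i j => (Gmat c y i j + σ * W i j) - Gmat c y i j) <
      frobSq (fun i j => (Gmat c y i j + σ * W i j) - Gmat c (y ∘ Equiv.swap u v) i j)) :
    σ * (c (y u) - c (y v)) * √(2 * n) * (vertexStat o v W - vertexStat o u W)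
      < 2 * n * (c (y u) - c (y v)) ^ 2 := by
  have hn : (0 : ℝ) < n := by exact_mod_cast o.pos
  set γ := c (y u) - c (y v) with hγ
  let d : Fin n → ℝ := fun i => γ * ((if i = u then 1 else 0) - (if i = v then 1 else 0))
  have hd : ∀ i, c (y i) - c (y (Equiv.swap u v i)) = d i := by
    intro i
    by_cases h1 : i = u
    · subst h1; simp [d, huv, hγ]
    · by_cases h2 : i = v
      · subst h2; simp [d, h1, hγ]
      · simp [d, h1, h2, Equiv.swap_apply_of_ne_of_ne h1 h2]
  have hsum : ∑ i, d i = 0 := by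
    simp [d, ← Finset.mul_sum]
  have hsq : ∑ i, d i ^ 2 = 2 * γ ^ 2 := by
    have : ∀ i, d i ^ 2 = γ ^ 2 * ((if i = u then 1 else 0) + (if i = v then 1 else 0)) := by
      intro i
      by_cases h1 : i = u
      · subst h1; simp [d, huv]
      · simp [d, h1]
    simp only [this, ← Finset.mul_sum, Finset.sum_add_distrib, Finset.sum_ite_eq',
      Finset.mem_univ, if_true]
    ring
  have hlin : ∑ i, d i * ∑ j, (W i j - W j i) =
      γ * (∑ j, (W u j - W j u) - ∑ j, (W v j - W j v)) := by
    have : ∀ (z : Fin n → ℝ), ∑ i, d i * z i = γ * (z u - z v) := by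
      intro z
      simp [d, mul_assoc, ← Finset.mul_sum, sub_mul, Finset.sum_sub_distrib]
    exact this _
  have hdiff := frobSq_add_sub (fun i j => σ * W i j) (fun i j => d i - d j)
  rw [sum_sub_sq_eq, hsum, hsq] at hdiff
  simp only [mul_assoc, ← Finset.mul_sum, sum_mul_sub_eq, hlin] at hdiff
  have e1 : (fun i j => (Gmat c y i j + σ * W i j) - Gmat c y i j) = fun i j => σ * W i j := by
    ext; ring
  have e2 : (fun i j => (Gmat c y i j + σ * W i j) - Gmat c (y ∘ Equiv.swap u v) i j)
      = fun i j => σ * W i j + (d i - d j) := by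
    ext i j
    rw [← hd i, ← hd j]
    simp only [Gmat, Function.comp_apply]
    ring
  rw [e1, e2] at h
  have hne : √(2 * (n : ℝ)) ≠ 0 := by positivity
  have hstat : √(2 * (n : ℝ)) * (vertexStat o v W - vertexStat o u W)
      = ∑ j, (W v j - W j v) - ∑ j, (W u j - W j u) := by
    simp only [vertexStat, ← mul_sub, ← mul_assoc, mul_inv_cancel₀ hne, one_mul]
    ring
  rw [mul_assoc _ (√_), hstat]
  nlinarith

lemma colorCard_comp_equiv {n k : ℕ} (x : Fin n → Fin k) (e : Equiv.Perm (Fin n)) (i : Fin k) :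
    colorCard (x ∘ e) i = colorCard x i := by
  unfold colorCard
  exact Finset.card_equiv e (by simp)

lemma exists_sq_sub_eq_sInf {k : ℕ} (hk : 2 ≤ k) (c : Fin k → ℝ) :
    ∃ a b : Fin k, a < b ∧
      (c a - c b) ^ 2 = sInf {r : ℝ | ∃ i j : Fin k, i < j ∧ r = (c i - c j) ^ 2} := by
  set S := {r : ℝ | ∃ i j : Fin k, i < j ∧ r = (c i - c j) ^ 2}
  have hfin : S.Finite := by
    refine (Set.finite_range fun p : Fin k × Fin k => (c p.1 - c p.2) ^ 2).subset ?_
    rintro r ⟨i, j, -, rfl⟩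
    exact ⟨(i, j), rfl⟩
  have hne : S.Nonempty :=
    ⟨_, ⟨0, by omega⟩, ⟨1, by omega⟩, by simp [Fin.lt_def], rfl⟩
  obtain ⟨a, b, hab, h⟩ := hne.csInf_mem hfin
  exact ⟨a, b, hab, h.symm⟩

/-- The probability that the truth `y` beats every assignment with the same color counts. -/
lemma gaussMatrix_unique_minimizer_le {n k : ℕ} (hn : 0 < n) (c : Fin k → ℝ) (y : Fin n → Fin k)
    {a b : Fin k} (hab : a ≠ b) {σ s m : ℝ} (hγ : σ * (c a - c b) ≠ 0) (hs : 0 ≤ s)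
    (hσs : 2 * n * (c a - c b) ^ 2 ≤ |σ * (c a - c b)| * √(2 * n) * (2 * s))
    (ha : m ≤ colorCard y a) (hb : m ≤ colorCard y b) :
    gaussMatrix n
        {W | ∀ x : Fin n → Fin k, (∀ i, colorCard x i = colorCard y i) → x ≠ y →
          frobSq (fun i j => (Gmat c y i j + σ * W i j) - Gmat c y i j) <
          frobSq (fun i j => (Gmat c y i j + σ * W i j) - Gmat c x i j)} ≤
      2 * ENNReal.ofReal
        (Real.exp (-((√(2 * Real.pi))⁻¹ * Real.exp (-(s + 1) ^ 2 / 2) * m))) := by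
  let o : Fin n := ⟨0, hn⟩
  obtain ⟨τ, hτ, hτabs⟩ : ∃ τ : ℝ, τ * τ = 1 ∧ σ * (c a - c b) = |σ * (c a - c b)| * τ := by
    rcases abs_cases (σ * (c a - c b)) with h | h
    · exact ⟨1, by norm_num, by rw [h.1]; ring⟩
    · exact ⟨-1, by norm_num, by rw [h.1]; ring⟩
  let colorClass (i : Fin k) : Finset (Fin n) := univ.filter fun v => y v = i
  have hsub : {W | ∀ x : Fin n → Fin k, (∀ i, colorCard x i = colorCard y i) → x ≠ y →
          frobSq (fun i j => (Gmat c y i j + σ * W i j) - Gmat c y i j) <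
          frobSq (fun i j => (Gmat c y i j + σ * W i j) - Gmat c x i j)} ⊆
      {W | ∀ v ∈ colorClass b, τ * vertexStat o v W < s} ∪
        {W | ∀ u ∈ colorClass a, -τ * vertexStat o u W < s} := by
    intro W hW
    by_contra hcon
    simp only [Set.mem_union, Set.mem_ofPred_eq, not_or, not_forall, not_lt] at hcon
    obtain ⟨⟨v, hv, hvs⟩, u, hu, hus⟩ := hcon
    have hyv : y v = b := by simpa [colorClass] using hv
    have hyu : y u = a := by simpa [colorClass] using hu
    have huv : u ≠ v := by
      rintro rfl
      exact hab (hyu.symm.trans hyv)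
    have hx : y ∘ Equiv.swap u v ≠ y := by
      intro h
      have := congrFun h u
      simp only [Function.comp_apply, Equiv.swap_apply_left] at this
      exact hab (hyu.symm.trans (this.symm.trans hyv))
    have hlt := vertexStat_of_swap c y o u v huv σ W
      (hW _ (fun i => colorCard_comp_equiv y _ i) hx)
    rw [hyu, hyv, hτabs] at hlt
    have hge : |σ * (c a - c b)| * √(2 * n) * (2 * s) ≤
        |σ * (c a - c b)| * √(2 * n) * (τ * vertexStat o v W - τ * vertexStat o u W) := by
      gcongr
      linarith
    linarith
  have hbound : ∀ (i : Fin k), m ≤ colorCard y i → ∀ t : ℝ, t * t = 1 →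
      gaussMatrix n {W | ∀ v ∈ colorClass i, t * vertexStat o v W < s} ≤ ENNReal.ofReal
        (Real.exp (-((√(2 * Real.pi))⁻¹ * Real.exp (-(s + 1) ^ 2 / 2) * m))) := by
    intro i hi t ht
    refine (gaussMatrix_forall_lt_le o ht _ hs).trans (ENNReal.ofReal_le_ofReal ?_)
    gcongr
    exact hi
  calc _ ≤ _ := (measure_mono hsub).trans (measure_union_le _ _)
    _ ≤ _ := add_le_add (hbound b hb τ hτ) (hbound a ha (-τ) (by rw [neg_mul_neg, hτ]))
    _ = _ := (two_mul _).symm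

lemma tendsto_exp_gaussian_tail_mul_atTop {δ κ : ℝ} (hδ : 0 < δ) (hκ : 0 < κ) :
    Tendsto (fun n : ℕ => κ * Real.exp (-(√(2 * Real.log n / (1 + δ)) + 1) ^ 2 / 2) * n)
      atTop atTop := by
  have hlog : Tendsto (fun n : ℕ => Real.log n) atTop atTop :=
    Real.tendsto_log_atTop.comp tendsto_natCast_atTop_atTop
  have hmain : Tendsto (fun n : ℕ =>
      κ * Real.exp (δ / 2 / (1 + δ) * Real.log n + -((1 + 2 / δ) / 2))) atTop atTop :=
    (Real.tendsto_exp_atTop.comp (tendsto_atTop_add_const_right _ _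
      (hlog.const_mul_atTop (by positivity)))).const_mul_atTop hκ
  refine tendsto_atTop_mono' _ ?_ hmain
  filter_upwards [eventually_ge_atTop 1] with n hn
  have hn0 : (0 : ℝ) < n := by exact_mod_cast hn
  have hL : 0 ≤ Real.log n := Real.log_nonneg (by exact_mod_cast hn)
  set s := √(2 * Real.log n / (1 + δ)) with hs
  have hs2 : s ^ 2 = 2 * Real.log n / (1 + δ) := Real.sq_sqrt (by positivity)
  have hamgm : 2 * s ≤ δ / 2 * s ^ 2 + 2 / δ := by
    have h := mul_nonneg (half_pos hδ).le (sq_nonneg (s - 2 / δ))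
    have e : δ / 2 * (s - 2 / δ) ^ 2 = δ / 2 * s ^ 2 - 2 * s + 2 / δ := by
      field_simp; ring
    linarith
  have hLs : Real.log n = (1 + δ) * s ^ 2 / 2 := by
    rw [hs2]; field_simp
  have hβ : δ / 2 / (1 + δ) * Real.log n = δ / 4 * s ^ 2 := by
    rw [hLs]; field_simp; ring
  calc κ * Real.exp (δ / 2 / (1 + δ) * Real.log n + -((1 + 2 / δ) / 2))
      ≤ κ * Real.exp (-(s + 1) ^ 2 / 2 + Real.log n) := by
        refine mul_le_mul_of_nonneg_left (Real.exp_le_exp.2 ?_) hκ.le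
        rw [hβ]
        linarith
    _ = κ * Real.exp (-(s + 1) ^ 2 / 2) * n := by
        rw [Real.exp_add, Real.exp_log hn0]
        ring

theorem exact_recovery_G_supercritical
    (k : ℕ) (hk : 2 ≤ k) (c : Fin k → ℝ) (hc : Function.Injective c)
    (C0 : ℝ)
    (hC0 : C0 = sInf {r : ℝ | ∃ i j : Fin k, i < j ∧ r = (c i - c j) ^ 2})
    (nn : ℕ → Fin k → ℕ)
    (hmono : ∀ n : ℕ, ∀ i j : Fin k, i ≤ j → nn n j ≤ nn n i)
    (hpos : ∀ n : ℕ, k ≤ n → ∀ i : Fin k, 0 < nn n i)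
    (hsum : ∀ n : ℕ, k ≤ n → ∑ i, nn n i = n)
    (cl : ℝ) (hcl : 0 < cl)
    (hlow : ∀ n : ℕ, k ≤ n → cl * n ≤ (nn n ⟨k - 1, by omega⟩ : ℝ))
    (y : (n : ℕ) → Fin n → Fin k)
    (hy : ∀ n : ℕ, k ≤ n → ∀ i : Fin k, colorCard (y n) i = nn n i)
    (σ : ℕ → ℝ) (δ : ℝ) (hδ : 0 < δ)
    (hσ : ∀ n : ℕ, k ≤ n → σ n ^ 2 > (1 + δ) * n * C0 / (4 * Real.log n)) :
    Tendsto (fun n : ℕ => gaussMatrix n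
        {W | ∀ x : Fin n → Fin k, (∀ i, colorCard x i = nn n i) → x ≠ y n →
          frobSq (fun i j => (Gmat c (y n) i j + σ n * W i j) - Gmat c (y n) i j) <
          frobSq (fun i j => (Gmat c (y n) i j + σ n * W i j) - Gmat c x i j)})
      atTop (nhds 0) ∧
    Tendsto (fun n : ℕ => gaussMatrix n
        {W | ∀ x : Fin n → Fin k, x ≠ y n →
          frobSq (fun i j => (Gmat c (y n) i j + σ n * W i j) - Gmat c (y n) i j) <
          frobSq (fun i j => (Gmat c (y n) i j + σ n * W i j) - Gmat c x i j)})
      atTop (nhds 0) := by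
  have hmin := exists_sq_sub_eq_sInf hk c
  rw [← hC0] at hmin
  obtain ⟨a, b, hab, hC⟩ := hmin
  have hγ : c a - c b ≠ 0 := sub_ne_zero.2 fun h => hab.ne (hc h)
  have hcard : ∀ n : ℕ, k ≤ n → ∀ i, cl * n ≤ colorCard (y n) i := by
    intro n hn i
    rw [hy n hn i]
    refine (hlow n hn).trans ?_
    exact_mod_cast hmono n i ⟨k - 1, by omega⟩ (Fin.le_def.2 (by simp only; omega))
  have hlim : Tendsto (fun n : ℕ => 2 * ENNReal.ofReal (Real.exp (-((√(2 * Real.pi))⁻¹ *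
      Real.exp (-(√(2 * Real.log n / (1 + δ)) + 1) ^ 2 / 2) * (cl * n))))) atTop (nhds 0) := by
    have h1 := tendsto_exp_gaussian_tail_mul_atTop hδ
      (mul_pos (inv_pos.2 (Real.sqrt_pos.2 Real.two_pi_pos)) hcl)
    have h2 := ENNReal.tendsto_ofReal (Real.tendsto_exp_neg_atTop_nhds_zero.comp h1)
    have h3 := ENNReal.Tendsto.const_mul (a := 2) h2 (Or.inr (by simp))
    rw [ENNReal.ofReal_zero, mul_zero] at h3
    refine h3.congr fun n => ?_
    simp only [Function.comp_apply]
    congr 4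
    ring
  have hfixed : Tendsto (fun n : ℕ => gaussMatrix n
        {W | ∀ x : Fin n → Fin k, (∀ i, colorCard x i = nn n i) → x ≠ y n →
          frobSq (fun i j => (Gmat c (y n) i j + σ n * W i j) - Gmat c (y n) i j) <
          frobSq (fun i j => (Gmat c (y n) i j + σ n * W i j) - Gmat c x i j)})
      atTop (nhds 0) := by
    refine tendsto_of_tendsto_of_tendsto_of_le_of_le' tendsto_const_nhds hlim
      (Eventually.of_forall fun _ => zero_le) ?_
    filter_upwards [eventually_ge_atTop k] with n hn
    have hn2 : (1 : ℝ) < n := by exact_mod_cast (by omega : 1 < n)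
    have hn0 : (0 : ℝ) < n := by linarith
    have hL : 0 < Real.log n := Real.log_pos hn2
    have hσn := hσ n hn
    rw [gt_iff_lt, ← hC, div_lt_iff₀ (by positivity)] at hσn
    have hσ0 : σ n ≠ 0 := by
      rintro h
      rw [h] at hσn
      have : 0 < (1 + δ) * n * (c a - c b) ^ 2 := by positivity
      linarith
    simp only [← hy n hn]
    refine gaussMatrix_unique_minimizer_le (by omega) c (y n) hab.ne (mul_ne_zero hσ0 hγ)
      (Real.sqrt_nonneg _) ?_ (hcard n hn a) (hcard n hn b)
    rw [← sq_le_sq₀ (by positivity) (by positivity)]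
    simp only [mul_pow, sq_abs]
    rw [Real.sq_sqrt (by positivity), Real.sq_sqrt (by positivity)]
    have e : σ n ^ 2 * (c a - c b) ^ 2 * (2 * n) * (2 ^ 2 * (2 * Real.log n / (1 + δ)))
        = 4 * n * (c a - c b) ^ 2 / (1 + δ) * (σ n ^ 2 * (4 * Real.log n)) := by ring
    rw [e]
    calc 2 ^ 2 * (n : ℝ) ^ 2 * ((c a - c b) ^ 2) ^ 2
        = 4 * n * (c a - c b) ^ 2 / (1 + δ) * ((1 + δ) * n * (c a - c b) ^ 2) := by
          field_simp; ring
      _ ≤ _ := by gcongr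
  refine ⟨hfixed, tendsto_of_tendsto_of_tendsto_of_le_of_le tendsto_const_nhds hfixed
    (fun _ => zero_le) fun n => measure_mono fun W hW x _ hx => hW x hx⟩
end

section
/- Fix an integer k ≥ 2 and distinct real numbers c_1,…,c_k. For each n, let n_1(n) ≥ … ≥ n_k(n) be positive integers summing to n, and assume there is a constant c > 0 (independent of n) with n_k(n) ≥ c·n for all n. Let y_n ∈ Ω_{n_1(n),…,n_k(n)} be the true color assignment and R_n = K(y_n) + σ_n W_n the observation. If there is a constant δ > 0 such that σ_n² < (1−δ)(n_k(n)+n_{k−1}(n))/(4 log n) for all n, then as n → ∞ both of the following probabilities tend to 1: (i) the probability that every minimizer of ‖R_n − K(x)‖_F² over x ∈ Ω_{2c/3} is equivalent to y_n; (ii) the probability that every minimizer of ‖R_n − K(x)‖_F² over x ∈ Ω_{n_1(n),…,n_k(n)} is equivalent to y_n. -/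
open MeasureTheory ProbabilityTheory Filter Finset

/-- The matrix `K(x)` with `K(x)_{ij} = 1` if `x(i) ≠ x(j)` and `0` otherwise. -/
noncomputable def Kmat {n k : ℕ} (x : Fin n → Fin k) : Fin n → Fin n → ℝ :=
  fun i j => if x i = x j then 0 else 1

/-- Two color assignments are equivalent if they induce the same partition of the vertices. -/
def ColorEquiv {n k : ℕ} (x z : Fin n → Fin k) : Prop :=
  ∀ i j : Fin n, x i = x j ↔ z i = z j

theorem measureReal_gaussMatrix_le_exp {n : ℕ} (B : Fin n → Fin n → ℝ) (e t : ℝ) (ht : 0 ≤ t) :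
    (gaussMatrix n).real {W | e ≤ ∑ i, ∑ j, B i j * W i j} ≤
      Real.exp (-t * e + t ^ 2 / 2 * frobSq B) := by
  have hprob : IsProbabilityMeasure (gaussMatrix n) := by
    unfold gaussMatrix; infer_instance
  have hexp : (fun W : Fin n → Fin n → ℝ => Real.exp (t * ∑ i, ∑ j, B i j * W i j)) =
      fun W => ∏ i, ∏ j, Real.exp ((t * B i j) * W i j) := by
    funext W
    simp only [← Real.exp_sum, Finset.mul_sum, mul_assoc]
  have hint : Integrable (fun W : Fin n → Fin n → ℝ =>
      Real.exp (t * ∑ i, ∑ j, B i j * W i j)) (gaussMatrix n) := by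
    rw [hexp]
    unfold gaussMatrix
    refine Integrable.fintype_prod
      (f := fun i (w : Fin n → ℝ) => ∏ j, Real.exp ((t * B i j) * w j)) fun i => ?_
    exact Integrable.fintype_prod
      (f := fun j (w : ℝ) => Real.exp ((t * B i j) * w)) fun j => integrable_exp_mul_gaussianReal _
  have hmgf : mgf (fun W : Fin n → Fin n → ℝ => ∑ i, ∑ j, B i j * W i j) (gaussMatrix n) t =
      Real.exp (t ^ 2 / 2 * frobSq B) := by
    rw [mgf, hexp]
    unfold gaussMatrix
    rw [integral_fintype_prod_eq_prod
      (f := fun i (w : Fin n → ℝ) => ∏ j, Real.exp ((t * B i j) * w j))]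
    have h1 : ∀ i, ∫ w : Fin n → ℝ, ∏ j, Real.exp ((t * B i j) * w j)
        ∂(Measure.pi fun _ : Fin n => gaussianReal 0 1) = ∏ j, Real.exp ((t * B i j) ^ 2 / 2) := by
      intro i
      rw [integral_fintype_prod_eq_prod (f := fun j (w : ℝ) => Real.exp ((t * B i j) * w))]
      refine Finset.prod_congr rfl fun j _ => ?_
      have := congrFun (mgf_id_gaussianReal (μ := 0) (v := 1)) (t * B i j)
      simpa [mgf] using this
    rw [Finset.prod_congr rfl fun i _ => h1 i]
    simp only [← Real.exp_sum, frobSq, Finset.mul_sum]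
    refine congrArg Real.exp (Finset.sum_congr rfl fun i _ => Finset.sum_congr rfl fun j _ => ?_)
    ring
  have := measure_ge_le_exp_mul_mgf (μ := gaussMatrix n)
    (X := fun W : Fin n → Fin n → ℝ => ∑ i, ∑ j, B i j * W i j) e ht hint
  rwa [hmgf, ← Real.exp_add] at this

theorem measureReal_frobSq_le {n k : ℕ} (x y : Fin n → Fin k) (σ s : ℝ) (hs : 0 < s)
    (hσ : σ ^ 2 ≤ s) :
    (gaussMatrix n).real {W | frobSq (fun i j => (Kmat y i j + σ * W i j) - Kmat x i j) ≤
        frobSq (fun i j => (Kmat y i j + σ * W i j) - Kmat y i j)} ≤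
      Real.exp (-(frobSq (fun i j => Kmat y i j - Kmat x i j) / (8 * s))) := by
  set D := frobSq (fun i j => Kmat y i j - Kmat x i j) with hD
  set B : Fin n → Fin n → ℝ := fun i j => -(2 * σ) * (Kmat y i j - Kmat x i j) with hB
  have hBD : frobSq B = 4 * σ ^ 2 * D := by
    simp only [hD, hB, frobSq, Finset.mul_sum]
    refine Finset.sum_congr rfl fun i _ => Finset.sum_congr rfl fun j _ => ?_
    ring
  have hD0 : 0 ≤ D := by
    rw [hD]; unfold frobSq; positivity
  have hset : {W | frobSq (fun i j => (Kmat y i j + σ * W i j) - Kmat x i j) ≤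
        frobSq (fun i j => (Kmat y i j + σ * W i j) - Kmat y i j)} =
      {W : Fin n → Fin n → ℝ | D ≤ ∑ i, ∑ j, B i j * W i j} := by
    ext W
    have : frobSq (fun i j => (Kmat y i j + σ * W i j) - Kmat x i j) =
        frobSq (fun i j => (Kmat y i j + σ * W i j) - Kmat y i j) + D
          - ∑ i, ∑ j, B i j * W i j := by
      simp only [hD, hB, frobSq, ← Finset.sum_add_distrib, ← Finset.sum_sub_distrib]
      refine Finset.sum_congr rfl fun i _ => Finset.sum_congr rfl fun j _ => ?_
      ring
    simp only [Set.mem_ofPred_eq, this]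
    constructor <;> intro h <;> linarith
  rw [hset]
  refine (measureReal_gaussMatrix_le_exp B D (1 / (4 * s)) (by positivity)).trans (Real.exp_le_exp.2 ?_)
  rw [hBD]
  have h1 : (1 / (4 * s)) ^ 2 / 2 * (4 * σ ^ 2 * D) ≤ (1 / (4 * s)) ^ 2 / 2 * (4 * s * D) := by
    gcongr
  have h2 : -(1 / (4 * s)) * D + (1 / (4 * s)) ^ 2 / 2 * (4 * s * D) = -(D / (8 * s)) := by
    field_simp; ring
  linarith

theorem sq_Kmat_sub {n k : ℕ} (x y : Fin n → Fin k) (v w : Fin n) :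
    (Kmat y v w - Kmat x v w) ^ 2 = if (x v = x w ↔ y v = y w) then 0 else 1 := by
  unfold Kmat
  by_cases h1 : x v = x w <;> by_cases h2 : y v = y w <;> simp [h1, h2]

theorem le_frobSq_Kmat_sub {n k : ℕ} (x y : Fin n → Fin k) (S : ℝ)
    (hS : ∀ a b : Fin k, a ≠ b → S ≤ (colorCard y a : ℝ) + colorCard y b) :
    2 * (hammingDist x y : ℝ) * (S - hammingDist x y) ≤
      frobSq (fun i j => Kmat y i j - Kmat x i j) := by
  classical
  let h : Fin n → Fin n → ℝ := fun v w =>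
    if x v ≠ y v ∧ x w = y w ∧ (y w = y v ∨ y w = x v) then 1 else 0
  have hpt : ∀ v w, h v w + h w v ≤ (Kmat y v w - Kmat x v w) ^ 2 := by
    intro v w
    rw [sq_Kmat_sub]
    simp only [h]
    split_ifs <;> first | (norm_num; done) | (exfalso; grind)
  have hrow : ∀ v, x v ≠ y v → S - hammingDist x y ≤ ∑ w, h v w := by
    intro v hv
    have h1 := hS (y v) (x v) (Ne.symm hv)
    have h2 : ∀ w, (if y w = y v then (1 : ℝ) else 0) + (if y w = x v then 1 else 0) ≤
        h v w + if x w ≠ y w then 1 else 0 := by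
      intro w
      simp only [h]
      split_ifs <;> first | (norm_num; done) | (exfalso; grind)
    have h3 := Finset.sum_le_sum fun w (_ : w ∈ Finset.univ) => h2 w
    simp only [Finset.sum_add_distrib, Finset.sum_boole] at h3
    unfold colorCard at h1
    unfold hammingDist at *
    linarith
  have hsum : (hammingDist x y : ℝ) * (S - hammingDist x y) ≤ ∑ v, ∑ w, h v w := by
    calc (hammingDist x y : ℝ) * (S - hammingDist x y)
        = ∑ v ∈ Finset.univ.filter (fun v => x v ≠ y v), (S - hammingDist x y) := by
          rw [Finset.sum_const, nsmul_eq_mul]; rfl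
      _ ≤ ∑ v ∈ Finset.univ.filter (fun v => x v ≠ y v), ∑ w, h v w :=
          Finset.sum_le_sum fun v hv => hrow v (Finset.mem_filter.1 hv).2
      _ ≤ ∑ v, ∑ w, h v w := by
          refine Finset.sum_le_sum_of_subset_of_nonneg (Finset.filter_subset _ _) fun v _ _ => ?_
          refine Finset.sum_nonneg fun w _ => ?_
          simp only [h]; split_ifs <;> norm_num
  have hcomm : ∑ v, ∑ w, h w v = ∑ v, ∑ w, h v w := Finset.sum_comm
  have := Finset.sum_le_sum fun v (_ : v ∈ Finset.univ) =>
    Finset.sum_le_sum fun w (_ : w ∈ Finset.univ) => hpt v w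
  simp only [Finset.sum_add_distrib, hcomm] at this
  unfold frobSq
  linarith

theorem card_mul_card_le_frobSq {n k : ℕ} (x y : Fin n → Fin k) (s t : Finset (Fin n))
    (hst : ∀ v ∈ s, ∀ w ∈ t, ¬(x v = x w ↔ y v = y w)) :
    (s.card : ℝ) * t.card ≤ frobSq (fun i j => Kmat y i j - Kmat x i j) := by
  unfold frobSq
  calc (s.card : ℝ) * t.card = ∑ v ∈ s, ∑ w ∈ t, (Kmat y v w - Kmat x v w) ^ 2 := by
        rw [Finset.sum_congr rfl fun v hv => Finset.sum_congr rfl fun w hw => by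
          rw [sq_Kmat_sub, if_neg (hst v hv w hw)]]
        simp
    _ ≤ ∑ v ∈ s, ∑ w, (Kmat y v w - Kmat x v w) ^ 2 :=
        Finset.sum_le_sum fun v _ => Finset.sum_le_sum_of_subset_of_nonneg
          (Finset.subset_univ _) fun w _ _ => sq_nonneg _
    _ ≤ _ := Finset.sum_le_sum_of_subset_of_nonneg (Finset.subset_univ _)
          fun v _ _ => Finset.sum_nonneg fun w _ => sq_nonneg _

theorem exists_perm_hammingDist_le {n k : ℕ} (x y : Fin n → Fin k) (q : ℝ) (hq : 0 ≤ q)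
    (hy : ∀ j, k * q < colorCard y j)
    (hD : frobSq (fun i j => Kmat y i j - Kmat x i j) < q ^ 2) :
    ∃ π : Equiv.Perm (Fin k), (hammingDist (π ∘ x) y : ℝ) ≤ k ^ 2 * q := by
  classical
  let T : Fin k → Fin k → Finset (Fin n) := fun i j => Finset.univ.filter fun v => x v = i ∧ y v = j
  have hlarge : ∀ j, ∃ i, q < ((T i j).card : ℝ) := by
    intro j
    by_contra! hcon
    have h1 : (colorCard y j : ℝ) = ∑ i, ((T i j).card : ℝ) := by
      unfold colorCard
      rw [Finset.card_eq_sum_card_fiberwise (f := x) (t := Finset.univ) (by simp)]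
      push_cast
      refine Finset.sum_congr rfl fun i _ => ?_
      rw [Finset.filter_filter]
      simp only [T, and_comm]
    have h2 : ∑ i, ((T i j).card : ℝ) ≤ k * q := by
      refine (Finset.sum_le_sum fun i _ => hcon i).trans ?_
      simp
    linarith [hy j]
  choose p hp using hlarge
  have hinj : Function.Injective p := by
    intro j j' hjj
    by_contra hne
    have h1 := card_mul_card_le_frobSq x y (T (p j) j) (T (p j') j') (by
      intro v hv w hw
      simp only [T, Finset.mem_filter, Finset.mem_univ, true_and] at hv hw
      rw [hv.1, hv.2, hw.1, hw.2]
      simp [hjj, hne])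
    nlinarith [hp j, hp j', mul_lt_mul'' (hp j) (hp j') hq hq]
  let e : Equiv.Perm (Fin k) := Equiv.ofBijective p (Finite.injective_iff_bijective.1 hinj)
  have hsmall : ∀ i j, i ≠ e j → ((T i j).card : ℝ) ≤ q := by
    intro i j hij
    by_contra! hcon
    have h1 := card_mul_card_le_frobSq x y (T i j) (T (p j) j) (by
      intro v hv w hw
      simp only [T, Finset.mem_filter, Finset.mem_univ, true_and] at hv hw
      rw [hv.1, hv.2, hw.1, hw.2]
      have : i ≠ p j := hij
      simp [this])
    nlinarith [mul_lt_mul'' hcon (hp j) hq hq]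
  refine ⟨e.symm, ?_⟩
  have hham : hammingDist (e.symm ∘ x) y = ∑ ij : Fin k × Fin k,
      ((Finset.univ.filter fun v => (e.symm ∘ x) v ≠ y v).filter
        fun v => (x v, y v) = ij).card := by
    unfold hammingDist
    exact Finset.card_eq_sum_card_fiberwise (by simp)
  rw [hham]
  push_cast
  refine (Finset.sum_le_sum (g := fun _ => q) fun ij _ => ?_).trans ?_
  · obtain ⟨i, j⟩ := ij
    by_cases hij : i = e j
    · have : ((Finset.univ.filter fun v => (e.symm ∘ x) v ≠ y v).filter
        fun v => (x v, y v) = (i, j)) = ∅ := by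
        rw [Finset.filter_filter, Finset.filter_eq_empty_iff]
        rintro v - ⟨h1, h2⟩
        simp only [Prod.mk.injEq] at h2
        apply h1
        simp [h2.1, h2.2, hij]
      rw [this]; simpa using hq
    · refine le_trans ?_ (hsmall i j hij)
      gcongr
      intro v hv
      simp only [Finset.mem_filter, Prod.mk.injEq] at hv
      simp [T, hv.2]
  · simp [Fintype.card_prod, sq]

theorem sum_pow_hammingDist_ne {n k : ℕ} (y : Fin n → Fin k) (q : ℝ) (hq : 0 ≤ q) :
    ∑ x ∈ Finset.univ.filter (fun x => x ≠ y), q ^ hammingDist x y ≤ (1 + k * q) ^ n - 1 := by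
  classical
  have h1 : ∑ x : Fin n → Fin k, q ^ hammingDist x y ≤ (1 + k * q) ^ n := by
    have h2 : ∀ x : Fin n → Fin k, q ^ hammingDist x y = ∏ v, if x v ≠ y v then q else 1 := by
      intro x
      rw [Finset.prod_ite]
      simp [hammingDist]
    calc ∑ x : Fin n → Fin k, q ^ hammingDist x y
        = ∏ v, ∑ a : Fin k, if a ≠ y v then q else 1 := by
          rw [Finset.prod_univ_sum, Fintype.piFinset_univ]
          exact Finset.sum_congr rfl fun x _ => h2 x
      _ ≤ ∏ _v : Fin n, (1 + k * q) := by
          refine Finset.prod_le_prod (fun v _ => Finset.sum_nonneg fun a _ => by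
            split_ifs <;> positivity) fun v _ => ?_
          have h3 : ∀ a, (if a ≠ y v then q else 1) ≤ (if a = y v then 1 else 0) + q := by
            intro a
            split_ifs <;> simp_all
          refine (Finset.sum_le_sum fun a _ => h3 a).trans ?_
          simp [Finset.sum_add_distrib]
      _ = (1 + k * q) ^ n := by simp
  have h4 : ∑ x : Fin n → Fin k, q ^ hammingDist x y =
      ∑ x ∈ Finset.univ.filter (fun x => x ≠ y), q ^ hammingDist x y + 1 := by
    rw [← Finset.sum_filter_add_sum_filter_not _ (fun x => x ≠ y)]
    simp [Finset.filter_eq']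
  linarith

/-- The noise matrices for which some coloring not equivalent to `y` fits the observation at
least as well as `y`. -/
def confusionEvent {n k : ℕ} (y : Fin n → Fin k) (σ : ℝ) : Set (Fin n → Fin n → ℝ) :=
  {W | ∃ x : Fin n → Fin k, ¬ ColorEquiv x y ∧
    frobSq (fun i j => (Kmat y i j + σ * W i j) - Kmat x i j) ≤
      frobSq (fun i j => (Kmat y i j + σ * W i j) - Kmat y i j)}

theorem Kmat_perm_comp {n k : ℕ} (π : Equiv.Perm (Fin k)) (x : Fin n → Fin k) :
    Kmat (π ∘ x) = Kmat x := by
  funext i j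
  simp [Kmat]

theorem measureReal_confusionEvent_le {n k : ℕ} (y : Fin n → Fin k) (σ s S q η : ℝ)
    (hs : 0 < s) (hσ : σ ^ 2 ≤ s) (hq : 0 ≤ q)
    (hS : ∀ a b : Fin k, a ≠ b → S ≤ (colorCard y a : ℝ) + colorCard y b)
    (hy : ∀ j, k * q < colorCard y j) (hη : k ^ 2 * q ≤ η * S) :
    (gaussMatrix n).real (confusionEvent y σ) ≤
      k ^ n * Real.exp (-(q ^ 2 / (8 * s))) +
        ((1 + k * Real.exp (-((1 - η) * S / (4 * s)))) ^ n - 1) := by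
  classical
  have hprob : IsProbabilityMeasure (gaussMatrix n) := by
    unfold gaussMatrix; infer_instance
  let F : (Fin n → Fin k) → Set (Fin n → Fin n → ℝ) := fun x =>
    {W | frobSq (fun i j => (Kmat y i j + σ * W i j) - Kmat x i j) ≤
        frobSq (fun i j => (Kmat y i j + σ * W i j) - Kmat y i j)}
  let D : (Fin n → Fin k) → ℝ := fun x => frobSq (fun i j => Kmat y i j - Kmat x i j)
  have hF : ∀ x, (gaussMatrix n).real (F x) ≤ Real.exp (-(D x / (8 * s))) := fun x =>
    measureReal_frobSq_le x y σ s hs hσ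
  let L : Finset (Fin n → Fin k) := Finset.univ.filter fun x => q ^ 2 ≤ D x
  let N : Finset (Fin n → Fin k) :=
    Finset.univ.filter fun x => x ≠ y ∧ (hammingDist x y : ℝ) ≤ k ^ 2 * q
  have hsub : confusionEvent y σ ⊆ (⋃ x ∈ L, F x) ∪ ⋃ x ∈ N, F x := by
    rintro W ⟨x, hne, hx⟩
    rcases le_or_gt (q ^ 2) (D x) with hDx | hDx
    · left
      exact Set.mem_biUnion (show x ∈ L by simpa [L] using hDx) hx
    · right
      obtain ⟨π, hπ⟩ := exists_perm_hammingDist_le x y q hq hy hDx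
      refine Set.mem_biUnion (show π ∘ x ∈ N from ?_) ?_
      · simp only [N, Finset.mem_filter, Finset.mem_univ, true_and]
        refine ⟨fun h => hne fun i j => ?_, hπ⟩
        rw [← h]
        simp
      · change frobSq _ ≤ frobSq _
        rw [Kmat_perm_comp]
        exact hx
  have hL : ∑ x ∈ L, (gaussMatrix n).real (F x) ≤ k ^ n * Real.exp (-(q ^ 2 / (8 * s))) := by
    calc ∑ x ∈ L, (gaussMatrix n).real (F x)
        ≤ ∑ x ∈ L, Real.exp (-(q ^ 2 / (8 * s))) := by
          refine Finset.sum_le_sum fun x hx => (hF x).trans ?_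
          have : q ^ 2 ≤ D x := (Finset.mem_filter.1 hx).2
          gcongr
      _ ≤ ∑ x : Fin n → Fin k, Real.exp (-(q ^ 2 / (8 * s))) :=
          Finset.sum_le_sum_of_subset_of_nonneg (Finset.subset_univ _)
            fun _ _ _ => (Real.exp_pos _).le
      _ = _ := by simp
  have hN : ∑ x ∈ N, (gaussMatrix n).real (F x) ≤
      (1 + k * Real.exp (-((1 - η) * S / (4 * s)))) ^ n - 1 := by
    refine le_trans ?_ (sum_pow_hammingDist_ne y _ (Real.exp_pos _).le)
    calc ∑ x ∈ N, (gaussMatrix n).real (F x)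
        ≤ ∑ x ∈ N, Real.exp (-((1 - η) * S / (4 * s))) ^ hammingDist x y := by
          refine Finset.sum_le_sum fun x hx => (hF x).trans ?_
          have h1 : (hammingDist x y : ℝ) ≤ k ^ 2 * q := (Finset.mem_filter.1 hx).2.2
          have h2 : 2 * (hammingDist x y : ℝ) * (S - hammingDist x y) ≤ D x :=
            le_frobSq_Kmat_sub x y S hS
          have h3 : 2 * (hammingDist x y : ℝ) * ((1 - η) * S) ≤ D x := by
            refine le_trans ?_ h2
            gcongr
            linarith
          rw [← Real.exp_nat_mul]
          refine Real.exp_le_exp.2 ?_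
          have h4 : (hammingDist x y : ℝ) * ((1 - η) * S / (4 * s)) =
              2 * (hammingDist x y : ℝ) * ((1 - η) * S) / (8 * s) := by
            field_simp; ring
          have h5 : 2 * (hammingDist x y : ℝ) * ((1 - η) * S) / (8 * s) ≤ D x / (8 * s) := by
            gcongr
          linarith
      _ ≤ _ := by
          refine Finset.sum_le_sum_of_subset_of_nonneg ?_ fun _ _ _ => by positivity
          intro x hx
          simp only [N, Finset.mem_filter, Finset.mem_univ, true_and] at hx ⊢
          exact hx.1
  calc (gaussMatrix n).real (confusionEvent y σ)
      ≤ (gaussMatrix n).real ((⋃ x ∈ L, F x) ∪ ⋃ x ∈ N, F x) := measureReal_mono hsub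
    _ ≤ (gaussMatrix n).real (⋃ x ∈ L, F x) + (gaussMatrix n).real (⋃ x ∈ N, F x) :=
        measureReal_union_le _ _
    _ ≤ _ := add_le_add ((measureReal_biUnion_finset_le _ _).trans hL)
        ((measureReal_biUnion_finset_le _ _).trans hN)

theorem tendsto_mul_rpow_neg_pow (k : ℕ) (β : ℝ) (hβ : 0 < β) :
    Tendsto (fun n : ℕ => (k * (n : ℝ) ^ (-β)) ^ n) atTop (nhds 0) := by
  have h1 : Tendsto (fun n : ℕ => (k : ℝ) * (n : ℝ) ^ (-β)) atTop (nhds 0) := by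
    simpa using ((tendsto_rpow_neg_atTop hβ).comp tendsto_natCast_atTop_atTop).const_mul (k : ℝ)
  refine tendsto_of_tendsto_of_tendsto_of_le_of_le' tendsto_const_nhds h1 ?_ ?_
  · exact Eventually.of_forall fun n => by positivity
  · filter_upwards [h1.eventually (gt_mem_nhds one_pos), eventually_ge_atTop 1] with n hn hn1
    exact pow_le_of_le_one (by positivity) hn.le (by omega)

theorem tendsto_one_add_mul_rpow_neg_pow (k : ℕ) (θ : ℝ) (hθ : 1 < θ) :
    Tendsto (fun n : ℕ => (1 + k * (n : ℝ) ^ (-θ)) ^ n - 1) atTop (nhds 0) := by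
  have h1 : Tendsto (fun n : ℕ => Real.exp ((k : ℝ) * (n : ℝ) ^ (-(θ - 1))) - 1) atTop
      (nhds 0) := by
    have h2 : Tendsto (fun n : ℕ => (k : ℝ) * (n : ℝ) ^ (-(θ - 1))) atTop (nhds 0) := by
      simpa using ((tendsto_rpow_neg_atTop (sub_pos.2 hθ)).comp
        tendsto_natCast_atTop_atTop).const_mul (k : ℝ)
    simpa using ((Real.continuous_exp.tendsto 0).comp h2).sub_const 1
  refine tendsto_of_tendsto_of_tendsto_of_le_of_le' tendsto_const_nhds h1 ?_ ?_
  · refine Eventually.of_forall fun n => sub_nonneg.2 (one_le_pow₀ ?_)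
    have : 0 ≤ (k : ℝ) * (n : ℝ) ^ (-θ) := by positivity
    linarith
  · filter_upwards [eventually_ge_atTop 1] with n hn
    have hn0 : (0 : ℝ) < n := by exact_mod_cast hn
    have h3 : (1 + k * (n : ℝ) ^ (-θ)) ^ n ≤ Real.exp ((k : ℝ) * (n : ℝ) ^ (-θ)) ^ n := by
      gcongr
      linarith [Real.add_one_le_exp ((k : ℝ) * (n : ℝ) ^ (-θ))]
    rw [← Real.exp_nat_mul] at h3
    have h4 : (n : ℝ) * (k * (n : ℝ) ^ (-θ)) = k * (n : ℝ) ^ (-(θ - 1)) := by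
      rw [show -(θ - 1) = -θ + 1 by ring, Real.rpow_add hn0, Real.rpow_one]
      ring
    rw [h4] at h3
    linarith

theorem tendsto_measure_one_of_compl_confusionEvent_subset {k : ℕ} (y : (n : ℕ) → Fin n → Fin k)
    (σ : ℕ → ℝ) (h : Tendsto (fun n => (gaussMatrix n).real (confusionEvent (y n) (σ n))) atTop
      (nhds 0)) (E : (n : ℕ) → Set (Fin n → Fin n → ℝ))
    (hE : ∀ᶠ n in atTop, (confusionEvent (y n) (σ n))ᶜ ⊆ E n) :
    Tendsto (fun n => gaussMatrix n (E n)) atTop (nhds 1) := by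
  have hprob : ∀ n, IsProbabilityMeasure (gaussMatrix n) := by
    intro n; unfold gaussMatrix; infer_instance
  have h1 : Tendsto (fun n => 1 - gaussMatrix n (confusionEvent (y n) (σ n))) atTop (nhds 1) := by
    have h2 : Tendsto (fun n => gaussMatrix n (confusionEvent (y n) (σ n))) atTop (nhds 0) := by
      have := ENNReal.tendsto_ofReal h
      simpa using this
    simpa using ENNReal.Tendsto.sub (tendsto_const_nhds (x := (1 : ENNReal))) h2 (by simp)
  refine tendsto_of_tendsto_of_tendsto_of_le_of_le' h1 tendsto_const_nhds ?_
    (Eventually.of_forall fun n => prob_le_one)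
  filter_upwards [hE] with n hn
  refine tsub_le_iff_left.2 ?_
  calc (1 : ENNReal) = gaussMatrix n Set.univ := measure_univ.symm
    _ ≤ gaussMatrix n (confusionEvent (y n) (σ n) ∪ E n) := by
        refine measure_mono fun W _ => ?_
        by_cases hW : W ∈ confusionEvent (y n) (σ n)
        · exact Or.inl hW
        · exact Or.inr (hn hW)
    _ ≤ _ := measure_union_le _ _

theorem exact_recovery_K_subcritical
    (k : ℕ) (hk : 2 ≤ k) (c : Fin k → ℝ) (hc : Function.Injective c)
    (nn : ℕ → Fin k → ℕ)
    (hmono : ∀ n : ℕ, ∀ i j : Fin k, i ≤ j → nn n j ≤ nn n i)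
    (hpos : ∀ n : ℕ, k ≤ n → ∀ i : Fin k, 0 < nn n i)
    (hsum : ∀ n : ℕ, k ≤ n → ∑ i, nn n i = n)
    (cl : ℝ) (hcl : 0 < cl)
    (hlow : ∀ n : ℕ, k ≤ n → cl * n ≤ (nn n ⟨k - 1, by omega⟩ : ℝ))
    (y : (n : ℕ) → Fin n → Fin k)
    (hy : ∀ n : ℕ, k ≤ n → ∀ i : Fin k, colorCard (y n) i = nn n i)
    (σ : ℕ → ℝ) (δ : ℝ) (hδ : 0 < δ)
    (hσ : ∀ n : ℕ, k ≤ n →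
      σ n ^ 2 < (1 - δ) * ((nn n ⟨k - 1, by omega⟩ : ℝ) + (nn n ⟨k - 2, by omega⟩ : ℝ)) /
        (4 * Real.log n)) :
    Tendsto (fun n : ℕ => gaussMatrix n
        {W | ∀ x : Fin n → Fin k,
          (∀ j : Fin k, 2 * cl / 3 * n ≤ (colorCard x j : ℝ)) →
          (∀ z : Fin n → Fin k, (∀ j : Fin k, 2 * cl / 3 * n ≤ (colorCard z j : ℝ)) →
            frobSq (fun i j => (Kmat (y n) i j + σ n * W i j) - Kmat x i j) ≤
            frobSq (fun i j => (Kmat (y n) i j + σ n * W i j) - Kmat z i j)) →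
          ColorEquiv x (y n)})
      atTop (nhds 1) ∧
    Tendsto (fun n : ℕ => gaussMatrix n
        {W | ∀ x : Fin n → Fin k,
          (∀ i : Fin k, colorCard x i = nn n i) →
          (∀ z : Fin n → Fin k, (∀ i : Fin k, colorCard z i = nn n i) →
            frobSq (fun i j => (Kmat (y n) i j + σ n * W i j) - Kmat x i j) ≤
            frobSq (fun i j => (Kmat (y n) i j + σ n * W i j) - Kmat z i j)) →
          ColorEquiv x (y n)})
      atTop (nhds 1) := by
  have hk0 : (0 : ℝ) < k := by positivity
  let S : ℕ → ℝ := fun n => (nn n ⟨k - 1, by omega⟩ : ℝ) + (nn n ⟨k - 2, by omega⟩ : ℝ)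
  have hlogpos : ∀ n : ℕ, k ≤ n → 0 < Real.log n := fun n hn =>
    Real.log_pos (by exact_mod_cast (by omega : 1 < n))
  have hSlow : ∀ n : ℕ, k ≤ n → 2 * cl * n ≤ S n := by
    intro n hn
    have h1 : (nn n ⟨k - 1, by omega⟩ : ℝ) ≤ nn n ⟨k - 2, by omega⟩ := by
      exact_mod_cast hmono n _ _ (Fin.mk_le_mk.2 (by omega))
    have := hlow n hn
    simp only [S]
    linarith
  have hSpos : ∀ n : ℕ, k ≤ n → 0 < S n := by
    intro n hn
    have : (0 : ℝ) < n := by exact_mod_cast (by omega : 0 < n)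
    exact lt_of_lt_of_le (by positivity) (hSlow n hn)
  have hcard : ∀ n : ℕ, k ≤ n → ∀ i, cl * n ≤ (nn n i : ℝ) := by
    intro n hn i
    refine (hlow n hn).trans ?_
    exact_mod_cast hmono n _ _ (Fin.le_def.2 (by simp; omega))
  have hδ1 : δ < 1 := by
    by_contra! hcon
    have h1 := hσ k le_rfl
    have h2 : (1 - δ) * S k / (4 * Real.log k) ≤ 0 :=
      div_nonpos_of_nonpos_of_nonneg
        (mul_nonpos_of_nonpos_of_nonneg (by linarith) (hSpos k le_rfl).le)
        (by have := hlogpos k le_rfl; positivity)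
    have h3 := sq_nonneg (σ k)
    simp only [S] at h2
    linarith
  set r : ℝ := cl * δ / k ^ 2 with hr
  have hrpos : 0 < r := by positivity
  set θ : ℝ := (1 - δ / 2) / (1 - δ) with hθ
  have h1δ : 0 < 1 - δ := by linarith
  have hθ1 : 1 < θ := by
    rw [hθ, lt_div_iff₀ h1δ]; linarith
  have hbound : ∀ n : ℕ, k ≤ n → (gaussMatrix n).real (confusionEvent (y n) (σ n)) ≤
      (k * (n : ℝ) ^ (-(r ^ 2 / 4))) ^ n + ((1 + k * (n : ℝ) ^ (-θ)) ^ n - 1) := by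
    intro n hn
    have hn0 : (0 : ℝ) < n := by exact_mod_cast (by omega : 0 < n)
    have hlog := hlogpos n hn
    have hSn := hSpos n hn
    set s : ℝ := (1 - δ) * S n / (4 * Real.log n) with hs
    have hspos : 0 < s := by positivity
    have hS : ∀ a b : Fin k, a ≠ b → S n ≤ (colorCard (y n) a : ℝ) + colorCard (y n) b := by
      have hlt : ∀ a b : Fin k, a < b → S n ≤ (nn n a : ℝ) + nn n b := by
        intro a b hab
        have h1 : nn n ⟨k - 1, by omega⟩ ≤ nn n b := hmono n _ _ (Fin.le_def.2 (by simp; omega))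
        have h2 : nn n ⟨k - 2, by omega⟩ ≤ nn n a := hmono n _ _ (Fin.le_def.2 (by simp; omega))
        simp only [S]
        have h1' : (nn n ⟨k - 1, by omega⟩ : ℝ) ≤ nn n b := by exact_mod_cast h1
        have h2' : (nn n ⟨k - 2, by omega⟩ : ℝ) ≤ nn n a := by exact_mod_cast h2
        linarith
      intro a b hab
      rw [hy n hn, hy n hn]
      rcases lt_or_gt_of_ne hab with h | h
      · exact hlt a b h
      · rw [add_comm]; exact hlt b a h
    have hyq : ∀ j, k * (r * n) < colorCard (y n) j := by
      intro j
      rw [hy n hn]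
      refine lt_of_lt_of_le ?_ (hcard n hn j)
      have hk1 : (1 : ℝ) ≤ k := by exact_mod_cast (by omega : 1 ≤ k)
      have h1 : k * (r * n) = cl * n * (δ / k) := by
        rw [hr]; field_simp
      have h2 : δ / k < 1 := by
        rw [div_lt_one hk0]; linarith
      rw [h1]
      exact mul_lt_of_lt_one_right (by positivity) h2
    have hη : k ^ 2 * (r * n) ≤ δ / 2 * S n := by
      have h1 : k ^ 2 * (r * n) = δ / 2 * (2 * cl * n) := by
        rw [hr]; field_simp
      rw [h1]
      gcongr
      exact hSlow n hn
    have hSup : S n ≤ 2 * n := by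
      have h1 : ∀ i, (nn n i : ℝ) ≤ n := by
        intro i
        have : nn n i ≤ ∑ j, nn n j := Finset.single_le_sum (fun _ _ => Nat.zero_le _) (mem_univ i)
        rw [hsum n hn] at this
        exact_mod_cast this
      simp only [S]
      linarith [h1 ⟨k - 1, by omega⟩, h1 ⟨k - 2, by omega⟩]
    refine (measureReal_confusionEvent_le (y n) (σ n) s (S n) (r * n) (δ / 2) hspos
      (hσ n hn).le (by positivity) hS hyq hη).trans ?_
    refine add_le_add ?_ (le_of_eq ?_)
    · rw [Real.rpow_def_of_pos hn0, mul_pow (k : ℝ), ← Real.exp_nat_mul]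
      refine mul_le_mul_of_nonneg_left (Real.exp_le_exp.2 ?_) (by positivity)
      have h1 : s ≤ n / (2 * Real.log n) := by
        rw [hs, div_le_div_iff₀ (by positivity) (by positivity)]
        nlinarith [mul_pos hδ hSn, mul_le_mul_of_nonneg_right hSup hlog.le,
          mul_pos (mul_pos hδ hSn) hlog]
      have h2 : (r * n) ^ 2 / (8 * (n / (2 * Real.log n))) ≤ (r * n) ^ 2 / (8 * s) := by
        gcongr
      have h3 : (r * n) ^ 2 / (8 * (n / (2 * Real.log n))) = n * (Real.log n * (r ^ 2 / 4)) := by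
        field_simp; ring
      linarith
    · rw [Real.rpow_def_of_pos hn0]
      have : (1 - δ / 2) * S n / (4 * s) = Real.log n * θ := by
        rw [hs, hθ]; field_simp
      rw [this, mul_neg]
  have hlim : Tendsto (fun n => (gaussMatrix n).real (confusionEvent (y n) (σ n))) atTop
      (nhds 0) := by
    have h1 := (tendsto_mul_rpow_neg_pow k (r ^ 2 / 4) (by positivity)).add
      (tendsto_one_add_mul_rpow_neg_pow k θ hθ1)
    rw [add_zero] at h1
    refine tendsto_of_tendsto_of_tendsto_of_le_of_le' tendsto_const_nhds h1
      (Eventually.of_forall fun n => measureReal_nonneg) ?_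
    filter_upwards [eventually_ge_atTop k] with n hn using hbound n hn
  constructor
  · refine tendsto_measure_one_of_compl_confusionEvent_subset y σ hlim _ ?_
    filter_upwards [eventually_ge_atTop k] with n hn W hW x _ hmin
    by_contra hne
    refine hW ⟨x, hne, hmin (y n) fun j => ?_⟩
    rw [hy n hn]
    refine le_trans ?_ (hcard n hn j)
    gcongr
    linarith
  · refine tendsto_measure_one_of_compl_confusionEvent_subset y σ hlim _ ?_
    filter_upwards [eventually_ge_atTop k] with n hn W hW x _ hmin
    by_contra hne
    exact hW ⟨x, hne, hmin (y n) (hy n hn)⟩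
end

section
/- Fix an integer k ≥ 2 and distinct real numbers c_1,…,c_k. For each n, let n_1(n) ≥ … ≥ n_k(n) be positive integers summing to n, and assume there is a constant c > 0 (independent of n) with n_k(n) ≥ c·n for all n. Let y_n ∈ Ω_{n_1(n),…,n_k(n)} be the true color assignment and R_n = K(y_n) + σ_n W_n the observation. If there is a constant δ > 0 such that σ_n² > (1+δ)(n_k(n)+n_{k−1}(n))/(4 log n) for all n, then as n → ∞ both of the following probabilities tend to 0: (i) the probability that every minimizer of ‖R_n − K(x)‖_F² over x ∈ Ω_{2c/3} is equivalent to y_n; (ii) the probability that every minimizer of ‖R_n − K(x)‖_F² over x ∈ Ω_{n_1(n),…,n_k(n)} is equivalent to y_n. -/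
open MeasureTheory ProbabilityTheory Filter Finset

theorem covariance_pi_sum_sum {ι E : Type*} [Fintype ι] [MeasurableSpace E] (ν : Measure E)
    [IsProbabilityMeasure ν] {f g : ι → E → ℝ} (hf : ∀ i, MemLp (f i) 2 ν)
    (hg : ∀ i, MemLp (g i) 2 ν) :
    cov[fun ω : ι → E => ∑ i, f i (ω i), fun ω => ∑ i, g i (ω i); Measure.pi fun _ => ν] =
      ∑ i, cov[f i, g i; ν] := by
  have hmp : ∀ i, MeasurePreserving (fun ω : ι → E => ω i) (Measure.pi fun _ => ν) ν :=
    fun i => measurePreserving_eval (fun _ => ν) i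
  have hF : ∀ i, MemLp (fun ω : ι → E => f i (ω i)) 2 (Measure.pi fun _ => ν) :=
    fun i => (hf i).comp_measurePreserving (hmp i)
  have hG : ∀ i, MemLp (fun ω : ι → E => g i (ω i)) 2 (Measure.pi fun _ => ν) :=
    fun i => (hg i).comp_measurePreserving (hmp i)
  rw [covariance_fun_sum_fun_sum hF hG]
  refine Finset.sum_congr rfl fun i _ => ?_
  rw [Finset.sum_eq_single i]
  · have h := covariance_map_fun (X := f i) (Y := g i) (μ := Measure.pi fun _ : ι => ν)
      (Z := fun ω : ι → E => ω i) (by rw [(hmp i).map_eq]; exact (hf i).1)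
      (by rw [(hmp i).map_eq]; exact (hg i).1) (hmp i).aemeasurable
    rw [(hmp i).map_eq] at h
    exact h.symm
  · intro j _ hji
    have h0 := (iIndepFun_pi (μ := fun _ : ι => ν) (X := fun _ => (id : E → E))
      fun _ => aemeasurable_id).indepFun hji.symm
    have h1 := h0.comp₀ (φ := f i) (ψ := g j) (hmp i).aemeasurable (hmp j).aemeasurable
      (by erw [(hmp i).map_eq]; exact (hf i).1.aemeasurable)
      (by erw [(hmp j).map_eq]; exact (hg j).1.aemeasurable)
    exact h1.covariance_eq_zero (hF i) (hG j)
  · simp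

theorem isGaussian_pi {ι E : Type*} [Fintype ι] [NormedAddCommGroup E] [NormedSpace ℝ E]
    [MeasurableSpace E] [BorelSpace E] [CompleteSpace E] [SecondCountableTopology E]
    (ν : Measure E) [IsGaussian ν] : IsGaussian (Measure.pi fun _ : ι => ν) := by
  have hmp : ∀ i, MeasurePreserving (fun ω : ι → E => ω i) (Measure.pi fun _ => ν) ν :=
    fun i => measurePreserving_eval (fun _ => ν) i
  have h := (iIndepFun_pi (μ := fun _ : ι => ν) (X := fun _ => (id : E → E))
      fun _ => aemeasurable_id).hasGaussianLaw
      (fun i => ⟨by simpa [(hmp i).map_eq] using ‹IsGaussian ν›⟩)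
  have := h.isGaussian_map
  simpa using this

theorem isGaussian_gaussMatrix (n : ℕ) : IsGaussian (gaussMatrix n) := by
  have := isGaussian_pi (ι := Fin n) (gaussianReal 0 1)
  exact isGaussian_pi _

/-- The Frobenius inner product with a fixed matrix, as a continuous linear functional. -/
noncomputable def frobDual {n : ℕ} (D : Fin n → Fin n → ℝ) : (Fin n → Fin n → ℝ) →L[ℝ] ℝ :=
  ∑ i, ∑ j, D i j •
    ((ContinuousLinearMap.proj j : (Fin n → ℝ) →L[ℝ] ℝ) ∘L ContinuousLinearMap.proj i)

theorem frobDual_apply {n : ℕ} (D W : Fin n → Fin n → ℝ) :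
    frobDual D W = ∑ i, ∑ j, D i j * W i j := by
  simp [frobDual]

theorem covariance_frobDual {n : ℕ} (D E : Fin n → Fin n → ℝ) :
    cov[frobDual D, frobDual E; gaussMatrix n] = ∑ i, ∑ j, D i j * E i j := by
  have hmem : ∀ a : ℝ, MemLp (fun x : ℝ => a * x) 2 (gaussianReal 0 1) := fun a =>
    (memLp_id_gaussianReal 2).const_mul a
  have hrow : ∀ d : Fin n → ℝ, MemLp (fun ω : Fin n → ℝ => ∑ j, d j * ω j) 2
      (Measure.pi fun _ : Fin n => gaussianReal 0 1) := fun d =>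
    memLp_finsetSum _ fun j _ => (hmem (d j)).comp_measurePreserving
      (measurePreserving_eval (fun _ : Fin n => gaussianReal 0 1) j)
  have h1 := covariance_pi_sum_sum (ι := Fin n) (Measure.pi fun _ : Fin n => gaussianReal 0 1)
    (f := fun i ω => ∑ j, D i j * ω j) (g := fun i ω => ∑ j, E i j * ω j)
    (fun i => hrow (D i)) (fun i => hrow (E i))
  have hD : (frobDual D : (Fin n → Fin n → ℝ) → ℝ) = fun W => ∑ i, ∑ j, D i j * W i j :=
    funext (frobDual_apply D)
  have hE : (frobDual E : (Fin n → Fin n → ℝ) → ℝ) = fun W => ∑ i, ∑ j, E i j * W i j :=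
    funext (frobDual_apply E)
  rw [hD, hE]
  refine h1.trans (Finset.sum_congr rfl fun i _ => ?_)
  rw [covariance_pi_sum_sum (gaussianReal 0 1) (fun j => hmem (D i j)) (fun j => hmem (E i j))]
  refine Finset.sum_congr rfl fun j _ => ?_
  rw [covariance_const_mul_left, covariance_const_mul_right]
  have : cov[fun x : ℝ => x, fun x => x; gaussianReal 0 1] = 1 := by
    rw [covariance_self aemeasurable_id']
    simp
  rw [this, mul_one]

theorem integral_frobDual {n : ℕ} (D : Fin n → Fin n → ℝ) :
    ∫ W, frobDual D W ∂gaussMatrix n = 0 := by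
  have := isGaussian_gaussMatrix n
  simp_rw [frobDual_apply]
  have hint : ∀ i j, Integrable (fun W : Fin n → Fin n → ℝ => D i j * W i j) (gaussMatrix n) := by
    intro i j
    exact (((ContinuousLinearMap.proj j : (Fin n → ℝ) →L[ℝ] ℝ) ∘L
      (ContinuousLinearMap.proj i : (Fin n → Fin n → ℝ) →L[ℝ] Fin n → ℝ)).integrable_comp
      (IsGaussian.integrable_id (μ := gaussMatrix n))).const_mul _
  rw [integral_finsetSum _ fun i _ => integrable_finsetSum _ fun j _ => hint i j]
  refine Finset.sum_eq_zero fun i _ => ?_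
  rw [integral_finsetSum _ fun j _ => hint i j]
  refine Finset.sum_eq_zero fun j _ => ?_
  rw [integral_const_mul]
  have hmp1 : MeasurePreserving (fun W : Fin n → Fin n → ℝ => W i) (gaussMatrix n)
    (Measure.pi fun _ => gaussianReal 0 1) :=
    measurePreserving_eval (fun _ : Fin n => Measure.pi fun _ : Fin n => gaussianReal 0 1) i
  have hmp := (measurePreserving_eval (fun _ : Fin n => gaussianReal 0 1) j).comp hmp1
  have h2 := integral_map (f := fun x : ℝ => x) hmp.aemeasurable
    (by exact measurable_id.aestronglyMeasurable)
  rw [hmp.map_eq, integral_id_gaussianReal] at h2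
  simp only [Function.comp_apply, Function.eval] at h2
  rw [← h2, mul_zero]

theorem map_frobDual {n : ℕ} (D : Fin n → Fin n → ℝ) :
    (gaussMatrix n).map (frobDual D) = gaussianReal 0 (frobSq D).toNNReal := by
  have := isGaussian_gaussMatrix n
  have hg : HasGaussianLaw (frobDual D) (gaussMatrix n) :=
    (IsGaussian.hasGaussianLaw_id (μ := gaussMatrix n)).map (frobDual D)
  rw [hg.map_eq_gaussianReal, integral_frobDual, ← covariance_self (by fun_prop),
    covariance_frobDual]
  simp [frobSq, sq]

theorem iIndepFun_frobDual {n : ℕ} {ι : Type*} [Finite ι] (U : ι → Fin n → Fin n → ℝ)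
    (h : ∀ a b, a ≠ b → ∑ i, ∑ j, U a i j * U b i j = 0) :
    iIndepFun (fun a => (frobDual (U a) : (Fin n → Fin n → ℝ) → ℝ)) (gaussMatrix n) := by
  have := isGaussian_gaussMatrix n
  have := Fintype.ofFinite ι
  refine HasGaussianLaw.iIndepFun_of_covariance_eq_zero ?_
    fun a b hab => (covariance_frobDual _ _).trans (h a b hab)
  exact (IsGaussian.hasGaussianLaw_id (μ := gaussMatrix n)).map
    (ContinuousLinearMap.pi fun a => frobDual (U a))

theorem gaussianReal_Ici_ge {v : ℝ} (hv : 0 < v) {t : ℝ} (ht : 0 ≤ t) :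
    ENNReal.ofReal ((√(2 * Real.pi))⁻¹ * Real.exp (-(t + √v) ^ 2 / (2 * v))) ≤
      gaussianReal 0 v.toNNReal (Set.Ici t) := by
  have hv0 : v.toNNReal ≠ 0 := by simpa using hv
  have hs : 0 < √v := Real.sqrt_pos.2 hv
  calc ENNReal.ofReal ((√(2 * Real.pi))⁻¹ * Real.exp (-(t + √v) ^ 2 / (2 * v)))
      = ENNReal.ofReal ((√(2 * Real.pi * v))⁻¹ * Real.exp (-(t + √v) ^ 2 / (2 * v))) *
          volume (Set.Icc t (t + √v)) := by
        rw [Real.volume_Icc, ← ENNReal.ofReal_mul (by positivity)]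
        congr 1
        rw [Real.sqrt_mul (by positivity) v]
        field_simp
        ring
    _ = ∫⁻ _ in Set.Icc t (t + √v),
          ENNReal.ofReal ((√(2 * Real.pi * v))⁻¹ * Real.exp (-(t + √v) ^ 2 / (2 * v))) := by
        rw [setLIntegral_const]
    _ ≤ ∫⁻ x in Set.Icc t (t + √v), gaussianPDF 0 v.toNNReal x := by
        refine setLIntegral_mono (measurable_gaussianPDF _ _) fun x hx => ?_
        rw [gaussianPDF, gaussianPDFReal]
        refine ENNReal.ofReal_le_ofReal ?_
        rw [Real.coe_toNNReal _ hv.le]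
        gcongr
        · simpa using ht.trans hx.1
        · simpa using hx.2
    _ ≤ ∫⁻ x in Set.Ici t, gaussianPDF 0 v.toNNReal x :=
        lintegral_mono_set Set.Icc_subset_Ici_self
    _ = _ := (gaussianReal_apply _ hv0 _).symm

theorem gaussMatrix_forall_frobDual_lt_le {n : ℕ} {ι : Type*} (S : Finset ι)
    (U : ι → Fin n → Fin n → ℝ) {v t : ℝ} (hv : 0 < v) (ht : 0 ≤ t)
    (hU : ∀ a ∈ S, frobSq (U a) = v)
    (horth : ∀ a ∈ S, ∀ b ∈ S, a ≠ b → ∑ i, ∑ j, U a i j * U b i j = 0) :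
    gaussMatrix n {W | ∀ a ∈ S, frobDual (U a) W < t} ≤ ENNReal.ofReal (Real.exp
      (-(S.card * ((√(2 * Real.pi))⁻¹ * Real.exp (-(t + √v) ^ 2 / (2 * v)))))) := by
  have := isGaussian_gaussMatrix n
  set q := (√(2 * Real.pi))⁻¹ * Real.exp (-(t + √v) ^ 2 / (2 * v)) with hq
  have hind := iIndepFun_frobDual (fun a : S => U a)
    fun a b hab => horth a a.2 b b.2 fun h => hab (Subtype.ext h)
  have h1 := hind.measure_inter_preimage_eq_mul Finset.univ (sets := fun _ => Set.Iio t)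
    fun _ _ => measurableSet_Iio
  have hone : ∀ a : S, gaussMatrix n (frobDual (U a) ⁻¹' Set.Iio t) ≤
      ENNReal.ofReal (Real.exp (-q)) := by
    intro a
    rw [← Measure.map_apply (by fun_prop) measurableSet_Iio, map_frobDual, hU a a.2,
      ← Set.compl_Ici, prob_compl_eq_one_sub measurableSet_Ici]
    calc 1 - gaussianReal 0 v.toNNReal (Set.Ici t) ≤ 1 - ENNReal.ofReal q :=
          tsub_le_tsub_left (gaussianReal_Ici_ge hv ht) _
      _ = ENNReal.ofReal (1 - q) := by
          rw [ENNReal.ofReal_sub _ (by positivity), ENNReal.ofReal_one]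
      _ ≤ _ := ENNReal.ofReal_le_ofReal (by linarith [Real.add_one_le_exp (-q)])
  have hset : {W | ∀ a ∈ S, frobDual (U a) W < t} =
      ⋂ a ∈ (Finset.univ : Finset S), frobDual (U a) ⁻¹' Set.Iio t := by
    ext W; simp
  rw [hset, h1]
  calc _ ≤ ∏ _a : S, ENNReal.ofReal (Real.exp (-q)) := Finset.prod_le_prod' fun a _ => hone a
    _ = _ := by
      rw [Finset.prod_const, ← ENNReal.ofReal_pow (by positivity), ← Real.exp_nat_mul]
      simp

theorem gaussMatrix_frobDual_ge_le {n : ℕ} (D : Fin n → Fin n → ℝ) {w s : ℝ} (hw : 0 < w)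
    (hs : 0 ≤ s) (hD : frobSq D ≤ w) :
    gaussMatrix n {W | s ≤ frobDual D W} ≤ ENNReal.ofReal (Real.exp (-s ^ 2 / (2 * w))) := by
  have := isGaussian_gaussMatrix n
  have h0 : 0 ≤ frobSq D := Finset.sum_nonneg fun i _ => Finset.sum_nonneg fun j _ => sq_nonneg _
  have hsub : HasSubgaussianMGF (frobDual D) w.toNNReal (gaussMatrix n) := by
    refine ⟨fun t => ?_, fun t => ?_⟩
    · have h1 := integrable_exp_mul_gaussianReal (μ := 0) (v := (frobSq D).toNNReal) t
      rw [← map_frobDual] at h1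
      exact h1.comp_measurable (by fun_prop)
    · rw [mgf_gaussianReal (map_frobDual D), Real.coe_toNNReal _ h0, Real.coe_toNNReal _ hw.le]
      simp only [zero_mul, zero_add]
      gcongr
  have h1 := hsub.measure_ge_le hs
  rw [Real.coe_toNNReal _ hw.le] at h1
  rw [← ofReal_measureReal]
  exact ENNReal.ofReal_le_ofReal h1

/-- The symmetric matrix `eₐ gᵀ + g eₐᵀ`. -/
def starMat {n : ℕ} (g : Fin n → ℝ) (a : Fin n) : Fin n → Fin n → ℝ :=
  fun i j => (if i = a then g j else 0) + (if j = a then g i else 0)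

theorem sum_starMat {n : ℕ} (g : Fin n → ℝ) (a : Fin n) :
    ∑ i, ∑ j, starMat g a i j = 2 * ∑ j, g j := by
  simp only [starMat, Finset.sum_add_distrib]
  rw [Finset.sum_comm]
  simp [two_mul]

theorem frobSq_starMat {n : ℕ} {g : Fin n → ℝ} {a : Fin n} (ha : g a = 0) :
    frobSq (starMat g a) = 2 * ∑ j, g j ^ 2 := by
  rw [frobSq, ← sum_starMat (fun j => g j ^ 2) a]
  refine Finset.sum_congr rfl fun i _ => Finset.sum_congr rfl fun j _ => ?_
  simp only [starMat]
  by_cases hi : i = a <;> by_cases hj : j = a <;> simp_all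

theorem starMat_orthogonal {n : ℕ} {g : Fin n → ℝ} {a b : Fin n} (ha : g a = 0) (hb : g b = 0)
    (hab : a ≠ b) : ∑ i, ∑ j, starMat g a i j * starMat g b i j = 0 := by
  refine Finset.sum_eq_zero fun i _ => Finset.sum_eq_zero fun j _ => ?_
  simp only [starMat]
  by_cases hi : i = a <;> by_cases hj : j = a <;> by_cases hi' : i = b <;>
    by_cases hj' : j = b <;> simp_all

theorem frobSq_le_of_sq_le_starMat {n : ℕ} {D : Fin n → Fin n → ℝ} {g : Fin n → ℝ} {a : Fin n}
    (h : ∀ i j, D i j ^ 2 ≤ starMat g a i j) : frobSq D ≤ 2 * ∑ j, g j := by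
  rw [← sum_starMat g a]
  exact Finset.sum_le_sum fun i _ => Finset.sum_le_sum fun j _ => h i j

theorem frobSq_le_of_sq_le_starMat_add {n : ℕ} {D : Fin n → Fin n → ℝ} {g : Fin n → ℝ}
    {a b : Fin n} (h : ∀ i j, D i j ^ 2 ≤ starMat g a i j + starMat g b i j) :
    frobSq D ≤ 4 * ∑ j, g j := by
  have : 4 * ∑ j, g j = ∑ i, ∑ j, (starMat g a i j + starMat g b i j) := by
    simp only [Finset.sum_add_distrib, sum_starMat]
    ring
  rw [this]
  exact Finset.sum_le_sum fun i _ => Finset.sum_le_sum fun j _ => h i j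

theorem frobSq_smul {n : ℕ} (r : ℝ) (D : Fin n → Fin n → ℝ) :
    frobSq (r • D) = r ^ 2 * frobSq D := by
  simp [frobSq, mul_pow, Finset.mul_sum]

theorem frobDual_smul {n : ℕ} (r : ℝ) (D W : Fin n → Fin n → ℝ) :
    frobDual (r • D) W = r * frobDual D W := by
  simp [frobDual_apply, Finset.mul_sum, mul_assoc]

theorem frobDual_sub {n : ℕ} (D E W : Fin n → Fin n → ℝ) :
    frobDual (D - E) W = frobDual D W - frobDual E W := by
  simp [frobDual_apply, sub_mul, Finset.sum_sub_distrib]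

section Moves

variable {n k : ℕ} (y : Fin n → Fin k) (α β : Fin k) (P : Finset (Fin n))

/-- The difference of the indicators of the color classes `α` and `β`, set to zero on `P`. -/
def classDiff : Fin n → ℝ := fun j =>
  if j ∈ P then 0 else (if y j = α then 1 else 0) - (if y j = β then 1 else 0)

/-- The change of `Kmat` when vertex `a` is recolored to `β`. -/
noncomputable def moveDiff (a : Fin n) : Fin n → Fin n → ℝ :=
  Kmat (Function.update y a β) - Kmat y

/-- The change of `Kmat` when vertices `a` and `b` exchange their colors. -/
noncomputable def swapDiff (a b : Fin n) : Fin n → Fin n → ℝ :=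
  Kmat (y ∘ Equiv.swap a b) - Kmat y

variable {y α β P}

theorem classDiff_of_mem {a : Fin n} (ha : a ∈ P) : classDiff y α β P a = 0 := by
  simp [classDiff, ha]

theorem sum_indicator_color (γ : Fin k) :
    ∑ j, (if y j = γ then (1 : ℝ) else 0) = colorCard y γ := by
  simp [colorCard]

theorem sum_classDiff_sq (hαβ : α ≠ β) {A B : Finset (Fin n)} (hA : ∀ a ∈ A, y a = α)
    (hB : ∀ b ∈ B, y b = β) :
    ∑ j, classDiff y α β (A ∪ B) j ^ 2 =
      (colorCard y α : ℝ) + colorCard y β - A.card - B.card := by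
  have h : ∀ j, classDiff y α β (A ∪ B) j ^ 2 = (if y j = α then (1 : ℝ) else 0) +
      (if y j = β then 1 else 0) - (if j ∈ A then 1 else 0) - (if j ∈ B then 1 else 0) := by
    intro j
    have h1 := hA j
    have h2 := hB j
    by_cases hjA : j ∈ A <;> by_cases hjB : j ∈ B
    · exact absurd ((h1 hjA).symm.trans (h2 hjB)) hαβ
    · simp [classDiff, hjA, hjB, h1 hjA, hαβ]
    · simp [classDiff, hjA, hjB, h2 hjB, hαβ.symm]
    · by_cases h3 : y j = α
      · simp [classDiff, hjA, hjB, h3, hαβ]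
      · by_cases h4 : y j = β <;> simp [classDiff, hjA, hjB, h3, h4, hαβ.symm]
  simp only [h, Finset.sum_sub_distrib, Finset.sum_add_distrib, sum_indicator_color]
  simp

theorem frobSq_moveDiff_le (hαβ : α ≠ β) {a : Fin n} (ha : y a = α) :
    frobSq (moveDiff y β a) ≤ 2 * ((colorCard y α : ℝ) + colorCard y β) := by
  rw [← sum_indicator_color, ← sum_indicator_color, ← Finset.sum_add_distrib]
  refine frobSq_le_of_sq_le_starMat (a := a) fun i j => ?_
  simp only [moveDiff, Kmat, starMat, Pi.sub_apply, Function.update_apply]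
  have := hαβ.symm
  by_cases hi : i = a <;> by_cases hj : j = a <;> simp only [hi, hj, ha] <;> split_ifs <;>
    first | (norm_num; done) | grind

theorem frobSq_moveDiff_sub_le (hαβ : α ≠ β) {a : Fin n} (ha : y a = α) (haP : a ∈ P) :
    frobSq (moveDiff y β a - starMat (classDiff y α β P) a) ≤ 2 * P.card := by
  have hP : (P.card : ℝ) = ∑ j, if j ∈ P then 1 else 0 := by simp
  rw [hP]
  refine frobSq_le_of_sq_le_starMat (a := a) fun i j => ?_
  simp only [moveDiff, Kmat, starMat, classDiff, Pi.sub_apply, Function.update_apply]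
  have := hαβ.symm
  by_cases hi : i = a <;> by_cases hj : j = a <;> simp only [hi, hj, ha, haP] <;> split_ifs <;>
    first | (norm_num; done) | grind

theorem frobSq_swapDiff_le (hαβ : α ≠ β) {a b : Fin n} (ha : y a = α) (hb : y b = β) :
    frobSq (swapDiff y a b) ≤ 4 * ((colorCard y α : ℝ) + colorCard y β) := by
  rw [← sum_indicator_color, ← sum_indicator_color, ← Finset.sum_add_distrib]
  refine frobSq_le_of_sq_le_starMat_add (a := a) (b := b) fun i j => ?_
  simp only [swapDiff, Kmat, starMat, Pi.sub_apply, Function.comp_apply, Equiv.swap_apply_def]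
  have := hαβ.symm
  have hab : a ≠ b := fun h => hαβ (ha.symm.trans (h ▸ hb))
  have hba := hab.symm
  by_cases hi : i = a <;> by_cases hj : j = a <;> by_cases hi' : i = b <;>
    by_cases hj' : j = b <;> simp only [hi, hj, hi', hj', ha, hb] <;> split_ifs <;>
    first | (norm_num; done) | grind

set_option maxHeartbeats 1000000 in
theorem frobSq_swapDiff_sub_le (hαβ : α ≠ β) {a b : Fin n} (ha : y a = α) (hb : y b = β)
    (haP : a ∈ P) (hbP : b ∈ P) :
    frobSq (swapDiff y a b - (starMat (classDiff y α β P) a - starMat (classDiff y α β P) b)) ≤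
      4 * P.card := by
  have hP : (P.card : ℝ) = ∑ j, if j ∈ P then 1 else 0 := by simp
  rw [hP]
  refine frobSq_le_of_sq_le_starMat_add (a := a) (b := b) fun i j => ?_
  simp only [swapDiff, Kmat, starMat, classDiff, Pi.sub_apply, Function.comp_apply,
    Equiv.swap_apply_def]
  have := hαβ.symm
  have hab : a ≠ b := fun h => hαβ (ha.symm.trans (h ▸ hb))
  have hba := hab.symm
  by_cases hi : i = a <;> by_cases hj : j = a <;> by_cases hi' : i = b <;>
    by_cases hj' : j = b <;> simp only [hi, hj, hi', hj', ha, hb, haP, hbP] <;> split_ifs <;>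
    first | (norm_num; done) | grind

theorem colorCard_comp_swap (a b : Fin n) (γ : Fin k) :
    colorCard (y ∘ Equiv.swap a b) γ = colorCard y γ := by
  refine Finset.card_bij (fun v _ => Equiv.swap a b v) (by simp) (by simp) fun v hv => ?_
  exact ⟨Equiv.swap a b v, by simpa using hv, by simp⟩

theorem colorCard_le_colorCard_update_add_one (a : Fin n) (γ : Fin k) :
    colorCard y γ ≤ colorCard (Function.update y a β) γ + 1 := by
  refine le_trans (Finset.card_le_card (t := insert a (Finset.univ.filter
    fun v => Function.update y a β v = γ)) fun v hv => ?_) (Finset.card_insert_le _ _)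
  by_cases hva : v = a <;> simp_all [Function.update_apply]

end Moves

theorem frobSq_residual {n : ℕ} (K L W : Fin n → Fin n → ℝ) (s : ℝ) :
    frobSq (fun i j => (K i j + s * W i j) - L i j) =
      frobSq (fun i j => (K i j + s * W i j) - K i j) -
        2 * s * frobDual (L - K) W + frobSq (L - K) := by
  simp only [frobSq, frobDual_apply, Finset.mul_sum, ← Finset.sum_sub_distrib,
    ← Finset.sum_add_distrib]
  refine Finset.sum_congr rfl fun i _ => Finset.sum_congr rfl fun j _ => ?_
  simp only [Pi.sub_apply]
  ring

theorem ColorEquiv.kmat_eq {n k : ℕ} {x z : Fin n → Fin k} (h : ColorEquiv x z) :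
    Kmat x = Kmat z := by
  funext i j
  simp [Kmat, h i j]

/-- If all least-squares estimators over `Ω` recover `y`, no competitor in `Ω` beats `y`. -/
theorem frobDual_le_of_forall_minimizer_colorEquiv {n k : ℕ} {Ω : (Fin n → Fin k) → Prop}
    {y : Fin n → Fin k} {s : ℝ} {W : Fin n → Fin n → ℝ}
    (h : ∀ x : Fin n → Fin k, Ω x → (∀ z : Fin n → Fin k, Ω z →
      frobSq (fun i j => (Kmat y i j + s * W i j) - Kmat x i j) ≤
      frobSq (fun i j => (Kmat y i j + s * W i j) - Kmat z i j)) → ColorEquiv x y)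
    {x : Fin n → Fin k} (hx : Ω x) :
    2 * s * frobDual (Kmat x - Kmat y) W ≤ frobSq (Kmat x - Kmat y) := by
  classical
  obtain ⟨x₀, hx₀, hmin⟩ := Finset.exists_min_image (Finset.univ.filter Ω)
    (fun z => frobSq (fun i j => (Kmat y i j + s * W i j) - Kmat z i j)) ⟨x, by simpa using hx⟩
  simp only [Finset.mem_filter, Finset.mem_univ, true_and] at hx₀ hmin
  have h1 := hmin x hx
  rw [(h x₀ hx₀ hmin).kmat_eq, frobSq_residual (Kmat y) (Kmat x)] at h1
  linarith

/-- A lower bound on the probability that `N(0, v) ≥ t`. -/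
noncomputable def gaussTail (v t : ℝ) : ℝ :=
  (√(2 * Real.pi))⁻¹ * Real.exp (-(t + √v) ^ 2 / (2 * v))

/-- The event that every least-squares estimator over the assignments satisfying `Ω` recovers the
partition given by `y`. -/
def recoveryEvent {n k : ℕ} (y : Fin n → Fin k) (s : ℝ) (Ω : (Fin n → Fin k) → Prop) :
    Set (Fin n → Fin n → ℝ) :=
  {W | ∀ x : Fin n → Fin k, Ω x → (∀ z : Fin n → Fin k, Ω z →
    frobSq (fun i j => (Kmat y i j + s * W i j) - Kmat x i j) ≤
    frobSq (fun i j => (Kmat y i j + s * W i j) - Kmat z i j)) → ColorEquiv x y}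

theorem exists_sign_factor (s : ℝ) : ∃ τ : ℝ, τ ^ 2 = 1 ∧ s = τ * |s| := by
  rcases le_total 0 s with h | h
  · exact ⟨1, by norm_num, by rw [abs_of_nonneg h, one_mul]⟩
  · exact ⟨-1, by norm_num, by rw [abs_of_nonpos h]; ring⟩

section Bounds

variable {n k : ℕ} {y : Fin n → Fin k} {α β : Fin k} {A B : Finset (Fin n)} {m : ℕ}

theorem gaussMatrix_forall_star_lt_le (hαβ : α ≠ β) (hA : ∀ a ∈ A, y a = α)
    (hB : ∀ b ∈ B, y b = β) (hAm : A.card = m) (hBm : B.card = m)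
    (hm : 2 * (m : ℝ) < colorCard y α + colorCard y β) {t : ℝ} (ht : 0 ≤ t)
    {τ : ℝ} (hτ : τ ^ 2 = 1) {S : Finset (Fin n)} (hS : S ⊆ A ∪ B) (hSm : S.card = m) :
    gaussMatrix n {W | ∀ a ∈ S, frobDual (τ • starMat (classDiff y α β (A ∪ B)) a) W < t} ≤
      ENNReal.ofReal (Real.exp
        (-(m * gaussTail (2 * (colorCard y α + colorCard y β - 2 * m)) t))) := by
  rw [← hSm]
  refine gaussMatrix_forall_frobDual_lt_le S _ (by rw [hSm]; linarith) ht (fun a ha => ?_)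
    fun a ha b hb hab => ?_
  · rw [frobSq_smul, hτ, one_mul, frobSq_starMat (classDiff_of_mem (hS ha)),
      sum_classDiff_sq hαβ hA hB, hAm, hBm, hSm]
    ring
  · have h := starMat_orthogonal (classDiff_of_mem (y := y) (α := α) (β := β) (hS ha))
      (classDiff_of_mem (hS hb)) hab
    calc _ = τ ^ 2 * ∑ i, ∑ j, starMat (classDiff y α β (A ∪ B)) a i j *
          starMat (classDiff y α β (A ∪ B)) b i j := by
          simp only [Finset.mul_sum, Pi.smul_apply, smul_eq_mul]
          exact Finset.sum_congr rfl fun i _ => Finset.sum_congr rfl fun j _ => by ring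
      _ = 0 := by rw [h, mul_zero]

theorem card_union_le_two_mul (hAm : A.card = m) (hBm : B.card = m) :
    ((A ∪ B).card : ℝ) ≤ 2 * m := by
  have := Finset.card_union_le A B
  rw [hAm, hBm] at this
  have h : ((A ∪ B).card : ℝ) ≤ m + m := by exact_mod_cast this
  linarith

theorem gaussMatrix_recoveryEvent_le_of_move (hαβ : α ≠ β) (hA : ∀ a ∈ A, y a = α)
    (hB : ∀ b ∈ B, y b = β) (hAm : A.card = m) (hBm : B.card = m) (hm0 : 0 < m)
    (hm : 2 * (m : ℝ) < colorCard y α + colorCard y β) {s T η : ℝ} (hT : 0 ≤ T) (hη : 0 ≤ η)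
    (hsT : (colorCard y α : ℝ) + colorCard y β ≤ |s| * T) {Ω : (Fin n → Fin k) → Prop}
    (hΩ : ∀ a ∈ A, Ω (Function.update y a β)) :
    gaussMatrix n (recoveryEvent y s Ω) ≤
      ENNReal.ofReal (Real.exp (-(m * gaussTail
        (2 * (colorCard y α + colorCard y β - 2 * m)) ((1 + η) * T)))) +
      m * ENNReal.ofReal (Real.exp (-(η * T) ^ 2 / (2 * (8 * m)))) := by
  obtain ⟨τ, hτ, hs⟩ := exists_sign_factor s
  set g := classDiff y α β (A ∪ B) with hg
  have hm0' : (0 : ℝ) < m := by exact_mod_cast hm0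
  have hsub : recoveryEvent y s Ω ⊆
      {W | ∀ a ∈ A, frobDual (τ • starMat g a) W < (1 + η) * T} ∪
      ⋃ a ∈ A, {W | η * T ≤ frobDual ((-τ) • (moveDiff y β a - starMat g a)) W} := by
    intro W hW
    by_contra hcon
    simp only [Set.mem_union, Set.mem_ofPred_eq, Set.mem_iUnion, not_or, not_forall, not_exists,
      not_le, not_lt, frobDual_smul, frobDual_sub] at hcon
    obtain ⟨⟨a, haA, h1⟩, h2⟩ := hcon
    have h2 := h2 a haA
    have h3 : 2 * s * frobDual (moveDiff y β a) W ≤ _ :=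
      (frobDual_le_of_forall_minimizer_colorEquiv hW (hΩ a haA)).trans
        (frobSq_moveDiff_le hαβ (hA a haA))
    have h4 : T < τ * frobDual (moveDiff y β a) W := by linarith
    have hspos : 0 < |s| := by
      by_contra h0
      have : |s| = 0 := le_antisymm (not_lt.1 h0) (abs_nonneg s)
      rw [this] at hsT
      linarith
    have h5 := mul_lt_mul_of_pos_left h4 hspos
    have h6 : 2 * s * frobDual (moveDiff y β a) W =
        2 * (|s| * (τ * frobDual (moveDiff y β a) W)) := by
      nth_rw 1 [hs]
      ring
    linarith
  refine (measure_mono hsub).trans ((measure_union_le _ _).trans (add_le_add ?_ ?_))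
  · exact gaussMatrix_forall_star_lt_le hαβ hA hB hAm hBm hm (by positivity) hτ
      Finset.subset_union_left hAm
  · refine (measure_biUnion_finset_le _ _).trans ((Finset.sum_le_card_nsmul _ _ _
      fun a ha => ?_).trans_eq (by rw [hAm, nsmul_eq_mul]))
    refine gaussMatrix_frobDual_ge_le _ (by positivity) (by positivity) ?_
    rw [frobSq_smul, neg_sq, hτ, one_mul]
    have h1 := frobSq_moveDiff_sub_le hαβ (hA a ha) (Finset.mem_union_left B ha)
    have h2 := card_union_le_two_mul hAm hBm
    linarith

theorem gaussMatrix_recoveryEvent_le_of_swap (hαβ : α ≠ β) (hA : ∀ a ∈ A, y a = α)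
    (hB : ∀ b ∈ B, y b = β) (hAm : A.card = m) (hBm : B.card = m) (hm0 : 0 < m)
    (hm : 2 * (m : ℝ) < colorCard y α + colorCard y β) {s T η : ℝ} (hT : 0 ≤ T) (hη : 0 ≤ η)
    (hsT : (colorCard y α : ℝ) + colorCard y β ≤ |s| * T) {Ω : (Fin n → Fin k) → Prop}
    (hΩ : ∀ a ∈ A, ∀ b ∈ B, Ω (y ∘ Equiv.swap a b)) :
    gaussMatrix n (recoveryEvent y s Ω) ≤
      2 * ENNReal.ofReal (Real.exp (-(m * gaussTail
        (2 * (colorCard y α + colorCard y β - 2 * m)) ((1 + η) * T)))) +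
      m ^ 2 * ENNReal.ofReal (Real.exp (-(η * T) ^ 2 / (2 * (8 * m)))) := by
  obtain ⟨τ, hτ, hs⟩ := exists_sign_factor s
  set g := classDiff y α β (A ∪ B) with hg
  have hm0' : (0 : ℝ) < m := by exact_mod_cast hm0
  have hsub : recoveryEvent y s Ω ⊆
      ({W | ∀ a ∈ A, frobDual (τ • starMat g a) W < (1 + η) * T} ∪
        {W | ∀ b ∈ B, frobDual ((-τ) • starMat g b) W < (1 + η) * T}) ∪
      ⋃ p ∈ A ×ˢ B, {W | η * T ≤
        frobDual ((-τ) • (swapDiff y p.1 p.2 - (starMat g p.1 - starMat g p.2))) W} := by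
    intro W hW
    by_contra hcon
    simp only [Set.mem_union, Set.mem_ofPred_eq, Set.mem_iUnion, not_or, not_forall, not_exists,
      not_le, not_lt, frobDual_smul, frobDual_sub, Finset.mem_product] at hcon
    obtain ⟨⟨⟨a, haA, h1⟩, ⟨b, hbB, h1'⟩⟩, h2⟩ := hcon
    have h2 := h2 (a, b) ⟨haA, hbB⟩
    have h3 : 2 * s * frobDual (swapDiff y a b) W ≤ _ :=
      (frobDual_le_of_forall_minimizer_colorEquiv hW (hΩ a haA b hbB)).trans
        (frobSq_swapDiff_le hαβ (hA a haA) (hB b hbB))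
    have h4 : 2 * T < τ * frobDual (swapDiff y a b) W := by
      have : 0 ≤ η * T := by positivity
      simp only at h2
      linarith
    have hspos : 0 < |s| := by
      by_contra h0
      have : |s| = 0 := le_antisymm (not_lt.1 h0) (abs_nonneg s)
      rw [this] at hsT
      linarith
    have h5 := mul_lt_mul_of_pos_left h4 hspos
    have h6 : 2 * s * frobDual (swapDiff y a b) W =
        2 * (|s| * (τ * frobDual (swapDiff y a b) W)) := by
      nth_rw 1 [hs]
      ring
    linarith
  refine (measure_mono hsub).trans ((measure_union_le _ _).trans (add_le_add ?_ ?_))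
  · rw [two_mul]
    refine (measure_union_le _ _).trans (add_le_add ?_ ?_)
    · exact gaussMatrix_forall_star_lt_le hαβ hA hB hAm hBm hm (by positivity) hτ
        Finset.subset_union_left hAm
    · exact gaussMatrix_forall_star_lt_le hαβ hA hB hAm hBm hm (by positivity) (by rwa [neg_sq])
        Finset.subset_union_right hBm
  · refine (measure_biUnion_finset_le _ _).trans ((Finset.sum_le_card_nsmul _ _ _
      fun p hp => ?_).trans_eq (by
        rw [Finset.card_product, hAm, hBm, nsmul_eq_mul, Nat.cast_mul, sq]))
    obtain ⟨ha, hb⟩ := Finset.mem_product.1 hp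
    refine gaussMatrix_frobDual_ge_le _ (by positivity) (by positivity) ?_
    rw [frobSq_smul, neg_sq, hτ, one_mul]
    have h1 := frobSq_swapDiff_sub_le hαβ (hA _ ha) (hB _ hb) (Finset.mem_union_left B ha)
      (Finset.mem_union_right A hb)
    have h2 := card_union_le_two_mul hAm hBm
    linarith

end Bounds

theorem three_mul_le_error_exponent {δ η c N L T n m : ℝ} (hδ : 0 < δ) (hL : 0 ≤ L)
    (hm0 : 0 < m) (hm : m ≤ η ^ 2 * c / (6 * (1 + δ)) * n) (hN : 2 * c * n ≤ N)
    (hT : T ^ 2 = 4 * N * L / (1 + δ)) : 3 * L ≤ (η * T) ^ 2 / (2 * (8 * m)) := by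
  have hδ' : 0 < 1 + δ := by linarith
  rw [le_div_iff₀ (by positivity), mul_pow, hT]
  have h1 : 48 * m * L ≤ 48 * (η ^ 2 * c / (6 * (1 + δ)) * n) * L := by gcongr
  have h2 : η ^ 2 * (4 * (2 * c * n) * L / (1 + δ)) ≤ η ^ 2 * (4 * N * L / (1 + δ)) := by gcongr
  have h3 : 48 * (η ^ 2 * c / (6 * (1 + δ)) * n) * L = η ^ 2 * (4 * (2 * c * n) * L / (1 + δ)) := by
    field_simp
    ring
  linarith

theorem main_exponent_le {δ η c N L T n m : ℝ} (hδ : 0 < δ) (hη : 0 < η) (hη1 : η ≤ 1)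
    (hL : 0 ≤ L) (hm : m ≤ η ^ 2 * c / (6 * (1 + δ)) * n) (hc : 0 < c) (hn : 0 < n)
    (hN : 2 * c * n ≤ N) (hT : T ^ 2 = 4 * N * L / (1 + δ)) :
    2 * m < N ∧ ((1 + η) * T + √(2 * (N - 2 * m))) ^ 2 / (2 * (2 * (N - 2 * m))) ≤
      (1 + η) ^ 4 / (1 + δ) * L + (1 + 1 / η) / 2 := by
  have hδ' : 0 < 1 + δ := by linarith
  have hcn : 0 < c * n := by positivity
  have hm1 : m ≤ η ^ 2 / 12 * N := by
    have h1 : η ^ 2 * c / (6 * (1 + δ)) * n ≤ η ^ 2 * c / 6 * n := by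
      gcongr
      linarith
    have h2 : η ^ 2 / 12 * (2 * c * n) ≤ η ^ 2 / 12 * N := by gcongr
    linarith
  have hN0 : 0 < N := by linarith
  have hm2 : m ≤ η / 12 * N := by
    have : η ^ 2 / 12 * N ≤ η / 12 * N := by
      gcongr
      nlinarith
    linarith
  have hm3 : 2 * m < N := by nlinarith
  refine ⟨hm3, ?_⟩
  set v := 2 * (N - 2 * m) with hv
  have hv0 : 0 < v := by linarith
  have hr : N ≤ (1 + η) * (N - 2 * m) := by nlinarith
  have hyoung : ((1 + η) * T + √v) ^ 2 ≤ (1 + η) * ((1 + η) * T) ^ 2 + (1 + 1 / η) * v := by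
    have hsq : √v ^ 2 = v := Real.sq_sqrt hv0.le
    have h : (1 + η) * ((1 + η) * T) ^ 2 + (1 + 1 / η) * √v ^ 2 - ((1 + η) * T + √v) ^ 2 =
        (η * ((1 + η) * T) - √v) ^ 2 / η := by
      field_simp
      ring
    have h' : 0 ≤ (η * ((1 + η) * T) - √v) ^ 2 / η := by positivity
    rw [hsq] at h
    linarith
  have hTv : (1 + η) * ((1 + η) * T) ^ 2 / (2 * v) ≤ (1 + η) ^ 4 / (1 + δ) * L := by
    rw [div_le_iff₀ (by positivity), mul_pow, hT]
    calc (1 + η) * ((1 + η) ^ 2 * (4 * N * L / (1 + δ)))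
        = (1 + η) ^ 3 / (1 + δ) * L * 4 * N := by ring
      _ ≤ (1 + η) ^ 3 / (1 + δ) * L * 4 * ((1 + η) * (N - 2 * m)) := by gcongr
      _ = _ := by rw [hv]; ring
  calc _ ≤ ((1 + η) * ((1 + η) * T) ^ 2 + (1 + 1 / η) * v) / (2 * v) := by gcongr
    _ = (1 + η) * ((1 + η) * T) ^ 2 / (2 * v) + (1 + 1 / η) / 2 := by field_simp
    _ ≤ _ := by gcongr

theorem tendsto_recovery_bound {ε θ C K : ℝ} (hε : 0 < ε) (hθ : θ < 1) (hK : 0 < K) :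
    Tendsto (fun n : ℕ => 2 * ENNReal.ofReal (Real.exp
        (-(⌊ε * n⌋₊ * (K * Real.exp (-(θ * Real.log n + C)))))) +
      ENNReal.ofReal ((n : ℝ) ^ 2 * Real.exp (-(3 * Real.log n)))) atTop (nhds 0) := by
  have h1 : Tendsto (fun n : ℕ => (n : ℝ) ^ (1 - θ)) atTop atTop :=
    (tendsto_rpow_atTop (by linarith)).comp tendsto_natCast_atTop_atTop
  have h2 : Tendsto (fun n : ℕ => (⌊ε * n⌋₊ : ℝ) * (K * Real.exp (-(θ * Real.log n + C))))
      atTop atTop := by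
    have h3 : Tendsto (fun n : ℕ => ε / 2 * K * Real.exp (-C) * (n : ℝ) ^ (1 - θ)) atTop atTop :=
      h1.const_mul_atTop (by positivity)
    refine tendsto_atTop_mono' _ ?_ h3
    filter_upwards [eventually_gt_atTop 0, (tendsto_natCast_atTop_atTop (R := ℝ)).eventually_ge_atTop
      (2 / ε)] with n hn hn2
    have hn0 : (0 : ℝ) < n := by exact_mod_cast hn
    rw [div_le_iff₀ hε] at hn2
    have hfl : ε / 2 * n ≤ ⌊ε * n⌋₊ := by
      have := Nat.lt_floor_add_one (ε * n)
      linarith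
    have he : Real.exp (-(θ * Real.log n + C)) = Real.exp (-C) * (n : ℝ) ^ (-θ) := by
      rw [Real.rpow_def_of_pos hn0, ← Real.exp_add]
      ring_nf
    have he2 : (n : ℝ) ^ (1 - θ) = n * (n : ℝ) ^ (-θ) := by
      rw [sub_eq_add_neg, Real.rpow_add hn0, Real.rpow_one]
    rw [he, he2]
    calc ε / 2 * K * Real.exp (-C) * (n * (n : ℝ) ^ (-θ))
        = ε / 2 * n * (K * (Real.exp (-C) * (n : ℝ) ^ (-θ))) := by ring
      _ ≤ _ := by gcongr
  have h4 := ENNReal.tendsto_ofReal (Real.tendsto_exp_neg_atTop_nhds_zero.comp h2)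
  have h5 : Tendsto (fun n : ℕ => ENNReal.ofReal ((n : ℝ) ^ 2 * Real.exp (-(3 * Real.log n))))
      atTop (nhds 0) := by
    have h6 := ENNReal.tendsto_ofReal (tendsto_inv_atTop_nhds_zero_nat (𝕜 := ℝ))
    rw [ENNReal.ofReal_zero] at h6
    refine h6.congr' ?_
    filter_upwards [eventually_gt_atTop 0] with n hn
    have hn0 : (0 : ℝ) < n := by exact_mod_cast hn
    congr 1
    have : Real.exp (-(3 * Real.log n)) = ((n : ℝ) ^ 3)⁻¹ := by
      rw [Real.exp_neg, show (3 : ℝ) * Real.log n = (3 : ℕ) * Real.log n by norm_num,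
        Real.exp_nat_mul, Real.exp_log hn0]
    rw [this]
    field_simp
  rw [ENNReal.ofReal_zero] at h4
  have h7 := (ENNReal.Tendsto.const_mul h4 (Or.inr (ENNReal.ofNat_ne_top (n := 2)))).add h5
  simpa using h7

theorem exists_margin {δ : ℝ} (hδ : 0 < δ) :
    ∃ η : ℝ, 0 < η ∧ η ≤ 1 ∧ (1 + η) ^ 4 / (1 + δ) < 1 := by
  have h1 : min δ 1 ≤ δ := min_le_left _ _
  have h2 : min δ 1 ≤ 1 := min_le_right _ _
  have h0 : 0 < min δ 1 := lt_min hδ one_pos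
  refine ⟨min δ 1 / 16, by positivity, by linarith, ?_⟩
  rw [div_lt_one (by linarith)]
  set η := min δ 1 / 16 with hη
  have hη0 : 0 < η := by positivity
  have hη1 : η ≤ 1 := by linarith
  have hsq : η ^ 2 ≤ η := by nlinarith
  have : (1 + η) ^ 4 ≤ 1 + 15 * η := by
    have h3 : (1 + η) ^ 2 ≤ 1 + 3 * η := by nlinarith
    calc (1 + η) ^ 4 = ((1 + η) ^ 2) ^ 2 := by ring
      _ ≤ (1 + 3 * η) ^ 2 := by gcongr
      _ ≤ 1 + 15 * η := by nlinarith
  linarith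

theorem recovery_bound_le {N : ℝ} {n m : ℕ} {δ η c T : ℝ} (hδ : 0 < δ) (hη : 0 < η) (hη1 : η ≤ 1)
    (hc : 0 < c) (hn : 0 < n) (hm0 : 0 < m) (hmn : m ≤ n)
    (hm : (m : ℝ) ≤ η ^ 2 * c / (6 * (1 + δ)) * n) (hN : 2 * c * n ≤ N)
    (hT : T ^ 2 = 4 * N * Real.log n / (1 + δ)) :
    2 * ENNReal.ofReal (Real.exp (-(m * gaussTail (2 * (N - 2 * m)) ((1 + η) * T)))) +
      m ^ 2 * ENNReal.ofReal (Real.exp (-(η * T) ^ 2 / (2 * (8 * m)))) ≤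
    2 * ENNReal.ofReal (Real.exp (-(m * ((√(2 * Real.pi))⁻¹ *
        Real.exp (-((1 + η) ^ 4 / (1 + δ) * Real.log n + (1 + 1 / η) / 2)))))) +
      ENNReal.ofReal ((n : ℝ) ^ 2 * Real.exp (-(3 * Real.log n))) := by
  have hn0 : (0 : ℝ) < n := by exact_mod_cast hn
  have hm0' : (0 : ℝ) < m := by exact_mod_cast hm0
  have hL : 0 ≤ Real.log n := Real.log_nonneg (by exact_mod_cast hn)
  have hmain := (main_exponent_le hδ hη hη1 hL hm hc hn0 hN hT).2
  have herr := three_mul_le_error_exponent hδ hL hm0' hm hN hT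
  gcongr ?_ + ?_
  · unfold gaussTail
    gcongr 2 * ENNReal.ofReal (Real.exp (-(_ * (_ * Real.exp ?_))))
    rw [neg_div]
    exact neg_le_neg hmain
  · rw [ENNReal.ofReal_mul (by positivity), ENNReal.ofReal_pow hn0.le, ENNReal.ofReal_natCast,
      neg_div]
    gcongr

theorem exact_recovery_K_supercritical
    (k : ℕ) (hk : 2 ≤ k) (c : Fin k → ℝ) (hc : Function.Injective c)
    (nn : ℕ → Fin k → ℕ)
    (hmono : ∀ n : ℕ, ∀ i j : Fin k, i ≤ j → nn n j ≤ nn n i)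
    (hpos : ∀ n : ℕ, k ≤ n → ∀ i : Fin k, 0 < nn n i)
    (hsum : ∀ n : ℕ, k ≤ n → ∑ i, nn n i = n)
    (cl : ℝ) (hcl : 0 < cl)
    (hlow : ∀ n : ℕ, k ≤ n → cl * n ≤ (nn n ⟨k - 1, by omega⟩ : ℝ))
    (y : (n : ℕ) → Fin n → Fin k)
    (hy : ∀ n : ℕ, k ≤ n → ∀ i : Fin k, colorCard (y n) i = nn n i)
    (σ : ℕ → ℝ) (δ : ℝ) (hδ : 0 < δ)
    (hσ : ∀ n : ℕ, k ≤ n →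
      σ n ^ 2 > (1 + δ) * ((nn n ⟨k - 1, by omega⟩ : ℝ) + (nn n ⟨k - 2, by omega⟩ : ℝ)) /
        (4 * Real.log n)) :
    Tendsto (fun n : ℕ => gaussMatrix n
        {W | ∀ x : Fin n → Fin k,
          (∀ j : Fin k, 2 * cl / 3 * n ≤ (colorCard x j : ℝ)) →
          (∀ z : Fin n → Fin k, (∀ j : Fin k, 2 * cl / 3 * n ≤ (colorCard z j : ℝ)) →
            frobSq (fun i j => (Kmat (y n) i j + σ n * W i j) - Kmat x i j) ≤
            frobSq (fun i j => (Kmat (y n) i j + σ n * W i j) - Kmat z i j)) →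
          ColorEquiv x (y n)})
      atTop (nhds 0) ∧
    Tendsto (fun n : ℕ => gaussMatrix n
        {W | ∀ x : Fin n → Fin k,
          (∀ i : Fin k, colorCard x i = nn n i) →
          (∀ z : Fin n → Fin k, (∀ i : Fin k, colorCard z i = nn n i) →
            frobSq (fun i j => (Kmat (y n) i j + σ n * W i j) - Kmat x i j) ≤
            frobSq (fun i j => (Kmat (y n) i j + σ n * W i j) - Kmat z i j)) →
          ColorEquiv x (y n)})
      atTop (nhds 0) := by
  obtain ⟨η, hη, hη1, hθ⟩ := exists_margin hδ
  have hδ' : 0 < 1 + δ := by linarith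
  set α : Fin k := ⟨k - 1, by omega⟩ with hα
  set β : Fin k := ⟨k - 2, by omega⟩ with hβ
  have hαβ : α ≠ β := by
    rw [hα, hβ, ne_eq, Fin.mk.injEq]
    omega
  set ε := η ^ 2 * cl / (6 * (1 + δ)) with hε
  have hε0 : 0 < ε := by positivity
  have hεcl : ε ≤ cl := by
    rw [hε, div_le_iff₀ (by positivity)]
    have : η ^ 2 ≤ 1 := pow_le_one₀ hη.le hη1
    nlinarith
  have hlim := tendsto_recovery_bound (C := (1 + 1 / η) / 2) (K := (√(2 * Real.pi))⁻¹) hε0 hθ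
    (by positivity)
  have hbound : ∀ᶠ n : ℕ in atTop, ∀ Ω : (Fin n → Fin k) → Prop,
      ((∀ a, y n a = α → Ω (Function.update (y n) a β)) ∨
        (∀ a b, Ω (y n ∘ Equiv.swap a b))) →
      gaussMatrix n (recoveryEvent (y n) (σ n) Ω) ≤
        2 * ENNReal.ofReal (Real.exp (-(⌊ε * n⌋₊ * ((√(2 * Real.pi))⁻¹ *
          Real.exp (-((1 + η) ^ 4 / (1 + δ) * Real.log n + (1 + 1 / η) / 2)))))) +
        ENNReal.ofReal ((n : ℝ) ^ 2 * Real.exp (-(3 * Real.log n))) := by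
    filter_upwards [eventually_ge_atTop k, (tendsto_natCast_atTop_atTop (R := ℝ)).eventually_ge_atTop
      (1 / ε)] with n hnk hnε Ω hΩ
    have hn2 : 2 ≤ n := hk.trans hnk
    have hn1 : (1 : ℝ) < n := by exact_mod_cast hn2
    have hL : 0 < Real.log n := Real.log_pos hn1
    have hα_le : cl * n ≤ colorCard (y n) α := by
      rw [hy n hnk α]
      exact hlow n hnk
    have hβ_le : (colorCard (y n) α : ℝ) ≤ colorCard (y n) β := by
      rw [hy n hnk α, hy n hnk β]
      exact_mod_cast hmono n β α (by rw [hα, hβ, Fin.mk_le_mk]; omega)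
    set N : ℝ := colorCard (y n) α + colorCard (y n) β with hN
    have hNle : 2 * cl * n ≤ N := by linarith
    have hN0 : 0 < N := lt_of_lt_of_le (by positivity) hNle
    set m := ⌊ε * n⌋₊ with hm
    have hm0 : 0 < m := by
      rw [hm, Nat.floor_pos]
      rwa [div_le_iff₀' hε0] at hnε
    have hmε : (m : ℝ) ≤ ε * n := Nat.floor_le (by positivity)
    have hmα : (m : ℝ) ≤ colorCard (y n) α :=
      (hmε.trans (by gcongr)).trans hα_le
    have hmα' : m ≤ colorCard (y n) α := by exact_mod_cast hmα
    have hmβ' : m ≤ colorCard (y n) β := by exact_mod_cast hmα.trans hβ_le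
    have hmn : m ≤ n := hmα'.trans ((Finset.card_filter_le _ _).trans (by simp))
    obtain ⟨A, hA, hAm⟩ := Finset.exists_subset_card_eq hmα'
    obtain ⟨B, hB, hBm⟩ := Finset.exists_subset_card_eq hmβ'
    have hA' : ∀ a ∈ A, y n a = α := fun a ha => (Finset.mem_filter.1 (hA ha)).2
    have hB' : ∀ b ∈ B, y n b = β := fun b hb => (Finset.mem_filter.1 (hB hb)).2
    have hT : √(4 * N * Real.log n / (1 + δ)) ^ 2 = 4 * N * Real.log n / (1 + δ) :=
      Real.sq_sqrt (by positivity)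
    set T := √(4 * N * Real.log n / (1 + δ)) with hTdef
    have hT0 : 0 ≤ T := Real.sqrt_nonneg _
    have hsT : N ≤ |σ n| * T := by
      refine le_of_sq_le_sq ?_ (by positivity)
      rw [mul_pow, hT, sq_abs]
      have h1 : (1 + δ) * N / (4 * Real.log n) ≤ σ n ^ 2 := by
        have := (hσ n hnk).le
        rwa [← hy n hnk, ← hy n hnk] at this
      calc N ^ 2 = (1 + δ) * N / (4 * Real.log n) * (4 * N * Real.log n / (1 + δ)) := by
            field_simp
        _ ≤ _ := by gcongr
    have h2m := (main_exponent_le hδ hη hη1 hL.le hmε hcl (by linarith) hNle hT).1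
    refine le_trans ?_ (recovery_bound_le hδ hη hη1 hcl (by omega) hm0 hmn hmε hNle hT)
    rcases hΩ with hΩ | hΩ
    · refine (gaussMatrix_recoveryEvent_le_of_move hαβ hA' hB' hAm hBm hm0 h2m hT0 hη.le hsT
        fun a ha => hΩ a (hA' a ha)).trans ?_
      gcongr
      · exact le_mul_of_one_le_left zero_le one_le_two
      · exact_mod_cast Nat.le_self_pow two_ne_zero m
    · exact gaussMatrix_recoveryEvent_le_of_swap hαβ hA' hB' hAm hBm hm0 h2m hT0 hη.le hsT
        fun a _ b _ => hΩ a b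
  refine ⟨tendsto_of_tendsto_of_tendsto_of_le_of_le' tendsto_const_nhds hlim
    (Eventually.of_forall fun _ => zero_le) ?_,
    tendsto_of_tendsto_of_tendsto_of_le_of_le' tendsto_const_nhds hlim
    (Eventually.of_forall fun _ => zero_le) ?_⟩
  · filter_upwards [hbound, eventually_ge_atTop k,
      (tendsto_natCast_atTop_atTop (R := ℝ)).eventually_ge_atTop (3 / cl)] with n hb hnk hn3
    refine hb (fun x => ∀ j : Fin k, 2 * cl / 3 * n ≤ (colorCard x j : ℝ)) (Or.inl ?_)
    intro a _ j
    rw [div_le_iff₀' hcl] at hn3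
    have h1 : (colorCard (y n) j : ℝ) ≤ colorCard (Function.update (y n) a β) j + 1 := by
      exact_mod_cast colorCard_le_colorCard_update_add_one a j
    have h2 : (nn n α : ℝ) ≤ colorCard (y n) j := by
      rw [hy n hnk j]
      exact_mod_cast hmono n j α (by rw [hα, Fin.le_def]; have := j.2; simp only; omega)
    have h3 : cl * n ≤ nn n α := hlow n hnk
    linarith
  · filter_upwards [hbound, eventually_ge_atTop k] with n hb hnk
    refine hb (fun x => ∀ i : Fin k, colorCard x i = nn n i) (Or.inr ?_)
    intro a b i
    rw [colorCard_comp_swap, hy n hnk i]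
end
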